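/- arXiv:2601.04125 — 3 statements merged into one kernel-verified Lean document; each statement's English description precedes it below -/
import Mathlib

section
/- Let F be a field with at least 3 elements, n = 4 and k = 2. Let 𝒳 be a non-linear maximal clique of Δ'_t, i.e., a maximal clique of Δ'_t such that there is no 2-dimensional subspace of F^4 contained in all subspaces Y with T^c(Y) ∈ 𝒳. Then: (1) there exists j ∈ {1,…,4} such that every Y with T^c(Y) ∈ 𝒳 contains the 1-dimensional subspace spanned by the standard basis vector e_j; (2) 𝒳 contains at most four elements; (3) for all distinct i, j ∈ {1,…,4}, no Y with T^c(Y) ∈ 𝒳 contains C_i ∩ C_j. -/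
open Module

section Defs

variable (F : Type*) [Field F]

/-- The `i`-th coordinate hyperplane in `F^n`: the kernel of the `i`-th coordinate functional. -/
def coordHyp (n : ℕ) (i : Fin n) : Submodule F (Fin n → F) :=
  LinearMap.ker (LinearMap.proj (R := F) (φ := fun _ : Fin n => F) i)

/-- A subspace of `F^n` is degenerate if it is contained in some coordinate hyperplane. -/
def IsDeg (n : ℕ) (W : Submodule F (Fin n → F)) : Prop :=
  ∃ i : Fin n, W ≤ coordHyp F n i

/-- A subspace of `F^n` is non-degenerate if it is not degenerate. -/
def IsNondeg (n : ℕ) (W : Submodule F (Fin n → F)) : Prop :=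
  ¬ IsDeg F n W

/-- Adjacency of `k`-dimensional subspaces: distinct with `(k-1)`-dimensional intersection. -/
def AdjK (n k : ℕ) (A B : Submodule F (Fin n → F)) : Prop :=
  A ≠ B ∧ finrank F ↥(A ⊓ B) = k - 1

/-- The star `S(X)`: all `k`-dimensional subspaces containing `X`. -/
def Sstar (n k : ℕ) (X : Submodule F (Fin n → F)) : Set (Submodule F (Fin n → F)) :=
  {A | finrank F ↥A = k ∧ X ≤ A}

/-- `S^c(X)`: all non-degenerate `k`-dimensional subspaces containing `X`. -/
def Sc (n k : ℕ) (X : Submodule F (Fin n → F)) : Set (Submodule F (Fin n → F)) :=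
  {A | finrank F ↥A = k ∧ X ≤ A ∧ IsNondeg F n A}

/-- `T^c(Y)`: all non-degenerate `k`-dimensional subspaces contained in `Y`. -/
def Tc (n k : ℕ) (Y : Submodule F (Fin n → F)) : Set (Submodule F (Fin n → F)) :=
  {A | finrank F ↥A = k ∧ A ≤ Y ∧ IsNondeg F n A}

/-- A clique of `Δ_k(V)`: a set of non-degenerate `k`-dimensional subspaces which are
pairwise adjacent. -/
def IsCliqueD (n k : ℕ) (C : Set (Submodule F (Fin n → F))) : Prop :=
  (∀ A ∈ C, finrank F ↥A = k ∧ IsNondeg F n A) ∧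
    ∀ A ∈ C, ∀ B ∈ C, A ≠ B → AdjK F n k A B

/-- A maximal clique of `Δ_k(V)`. -/
def IsMaxCliqueD (n k : ℕ) (C : Set (Submodule F (Fin n → F))) : Prop :=
  IsCliqueD F n k C ∧ ∀ D, IsCliqueD F n k D → C ⊆ D → D = C

/-- A star of `Δ_k(V)`: a set `S^c(X)` which is a maximal clique of `Δ_k(V)`. -/
def IsStarD (n k : ℕ) (S : Set (Submodule F (Fin n → F))) : Prop :=
  (∃ X : Submodule F (Fin n → F), finrank F ↥X = k - 1 ∧ S = Sc F n k X) ∧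
    IsMaxCliqueD F n k S

/-- A top of `Δ_k(V)`: a set `T^c(Y)` which is a maximal clique of `Δ_k(V)`. -/
def IsTopD (n k : ℕ) (T : Set (Submodule F (Fin n → F))) : Prop :=
  (∃ Y : Submodule F (Fin n → F), finrank F ↥Y = k + 1 ∧ T = Tc F n k Y) ∧
    IsMaxCliqueD F n k T

/-- Adjacency of maximal cliques used in the graphs `Δ_s` and `Δ_t`:
two distinct cliques such that every vertex of each is adjacent to some vertex of the other. -/
def AdjMC (n k : ℕ) (C1 C2 : Set (Submodule F (Fin n → F))) : Prop :=
  C1 ≠ C2 ∧ (∀ A ∈ C1, ∃ B ∈ C2, AdjK F n k A B) ∧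
    (∀ A ∈ C2, ∃ B ∈ C1, AdjK F n k A B)

/-- Adjacency in the graphs `Δ'_s` and `Δ'_t`: adjacent as above with empty intersection. -/
def AdjMC' (n k : ℕ) (C1 C2 : Set (Submodule F (Fin n → F))) : Prop :=
  AdjMC F n k C1 C2 ∧ C1 ∩ C2 = ∅

/-- A clique of the graph `Δ_s` (whose vertices are the stars of `Δ_k(V)`). -/
def IsCliqueDs (n k : ℕ) (𝔖 : Set (Set (Submodule F (Fin n → F)))) : Prop :=
  (∀ S ∈ 𝔖, IsStarD F n k S) ∧ ∀ S ∈ 𝔖, ∀ S' ∈ 𝔖, S ≠ S' → AdjMC F n k S S'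

/-- A maximal clique of `Δ_s`. -/
def IsMaxCliqueDs (n k : ℕ) (𝔖 : Set (Set (Submodule F (Fin n → F)))) : Prop :=
  IsCliqueDs F n k 𝔖 ∧ ∀ 𝔖', IsCliqueDs F n k 𝔖' → 𝔖 ⊆ 𝔖' → 𝔖' = 𝔖

/-- A clique of the graph `Δ'_s`. -/
def IsCliqueDs' (n k : ℕ) (𝔖 : Set (Set (Submodule F (Fin n → F)))) : Prop :=
  (∀ S ∈ 𝔖, IsStarD F n k S) ∧ ∀ S ∈ 𝔖, ∀ S' ∈ 𝔖, S ≠ S' → AdjMC' F n k S S'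

/-- A maximal clique of `Δ'_s`. -/
def IsMaxCliqueDs' (n k : ℕ) (𝔖 : Set (Set (Submodule F (Fin n → F)))) : Prop :=
  IsCliqueDs' F n k 𝔖 ∧ ∀ 𝔖', IsCliqueDs' F n k 𝔖' → 𝔖 ⊆ 𝔖' → 𝔖' = 𝔖

/-- A special set of stars: a maximal clique in both `Δ_s` and `Δ'_s`. -/
def IsSpecialStars (n k : ℕ) (𝔖 : Set (Set (Submodule F (Fin n → F)))) : Prop :=
  IsMaxCliqueDs F n k 𝔖 ∧ IsMaxCliqueDs' F n k 𝔖

/-- A clique of the graph `Δ_t` (whose vertices are the tops of `Δ_k(V)`). -/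
def IsCliqueDt (n k : ℕ) (𝔗 : Set (Set (Submodule F (Fin n → F)))) : Prop :=
  (∀ T ∈ 𝔗, IsTopD F n k T) ∧ ∀ T ∈ 𝔗, ∀ T' ∈ 𝔗, T ≠ T' → AdjMC F n k T T'

/-- A maximal clique of `Δ_t`. -/
def IsMaxCliqueDt (n k : ℕ) (𝔗 : Set (Set (Submodule F (Fin n → F)))) : Prop :=
  IsCliqueDt F n k 𝔗 ∧ ∀ 𝔗', IsCliqueDt F n k 𝔗' → 𝔗 ⊆ 𝔗' → 𝔗' = 𝔗

/-- A clique of the graph `Δ'_t`. -/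
def IsCliqueDt' (n k : ℕ) (𝔗 : Set (Set (Submodule F (Fin n → F)))) : Prop :=
  (∀ T ∈ 𝔗, IsTopD F n k T) ∧ ∀ T ∈ 𝔗, ∀ T' ∈ 𝔗, T ≠ T' → AdjMC' F n k T T'

/-- A maximal clique of `Δ'_t`. -/
def IsMaxCliqueDt' (n k : ℕ) (𝔗 : Set (Set (Submodule F (Fin n → F)))) : Prop :=
  IsCliqueDt' F n k 𝔗 ∧ ∀ 𝔗', IsCliqueDt' F n k 𝔗' → 𝔗 ⊆ 𝔗' → 𝔗' = 𝔗

/-- A special set of tops: a maximal clique in both `Δ_t` and `Δ'_t`. -/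
def IsSpecialTops (n k : ℕ) (𝔗 : Set (Set (Submodule F (Fin n → F)))) : Prop :=
  IsMaxCliqueDt F n k 𝔗 ∧ IsMaxCliqueDt' F n k 𝔗

/-- `𝔗_X`: the set of all `T^c(Y)` over non-degenerate `(k+1)`-dimensional `Y` containing `X`. -/
def TopsThrough (n k : ℕ) (X : Submodule F (Fin n → F)) :
    Set (Set (Submodule F (Fin n → F))) :=
  {T | ∃ Y : Submodule F (Fin n → F),
    finrank F ↥Y = k + 1 ∧ IsNondeg F n Y ∧ X ≤ Y ∧ T = Tc F n k Y}

end Defs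

section CoordinateCliques

variable {F : Type*} [Field F]

/-- Two vectors are proportional, with nonzero ratio, away from the `i`-th coordinate. -/
def PropOff (i : Fin 4) (u v : Fin 4 → F) : Prop :=
  ∃ c : F, c ≠ 0 ∧ ∀ m, m ≠ i → u m = c * v m

namespace PropOff

variable {i : Fin 4} {u v w : Fin 4 → F}

lemma of_smul {c : F} (hc : c ≠ 0) (i : Fin 4) (v : Fin 4 → F) : PropOff i (c • v) v :=
  ⟨c, hc, fun _ _ => rfl⟩

lemma symm (h : PropOff i u v) : PropOff i v u := by
  obtain ⟨c, hc, h⟩ := h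
  exact ⟨c⁻¹, inv_ne_zero hc, fun m hm => by rw [h m hm, inv_mul_cancel_left₀ hc]⟩

lemma trans (h : PropOff i u v) (h' : PropOff i v w) : PropOff i u w := by
  obtain ⟨c, hc, h⟩ := h
  obtain ⟨d, hd, h'⟩ := h'
  exact ⟨c * d, mul_ne_zero hc hd, fun m hm => by rw [h m hm, h' m hm, mul_assoc]⟩

lemma eq_zero (h : PropOff i u v) {m : Fin 4} (hm : m ≠ i) (hv : v m = 0) : u m = 0 := by
  obtain ⟨c, -, h⟩ := h
  rw [h m hm, hv, mul_zero]

lemma exists_eq_add_single (h : PropOff i u v) :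
    ∃ c d : F, c ≠ 0 ∧ u = c • v + d • Pi.single i 1 := by
  obtain ⟨c, hc, h⟩ := h
  refine ⟨c, u i - c * v i, hc, funext fun m => ?_⟩
  by_cases hm : m = i
  · subst hm; simp
  · simp [hm, h m hm]

lemma exists_eq_smul (h : PropOff i u v) (hu : u i = 0) (hv : v i = 0) :
    ∃ c : F, c ≠ 0 ∧ u = c • v := by
  obtain ⟨c, hc, h⟩ := h
  refine ⟨c, hc, funext fun m => ?_⟩
  by_cases hm : m = i
  · subst hm; simp [hu, hv]
  · simp [h m hm]

/-- Vectors agreeing with `u` away from a common coordinate all lie on one line. -/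
lemma exists_eq_combination (huv : PropOff i u v) (huw : PropOff i u w)
    (hv : ∀ c : F, v ≠ c • u) : ∃ a b : F, w = a • u + b • v := by
  obtain ⟨c, d, -, h⟩ := huv.symm.exists_eq_add_single
  obtain ⟨c', d', -, h'⟩ := huw.symm.exists_eq_add_single
  have hd : d ≠ 0 := by
    rintro rfl
    exact hv c (by simpa using h)
  refine ⟨c' - d' * d⁻¹ * c, d' * d⁻¹, ?_⟩
  have hs : (Pi.single i 1 : Fin 4 → F) = d⁻¹ • (v - c • u) := by
    rw [h]; simp [smul_smul, inv_mul_cancel₀ hd]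
  rw [h', hs]
  module

/-- Vectors proportional away from `i` and away from `j` are proportional as soon as they do not
vanish at some further coordinate. -/
lemma exists_eq_smul_of_ne {j k : Fin 4} (hi : PropOff i u v) (hj : PropOff j u v) (hij : i ≠ j)
    (hki : k ≠ i) (hkj : k ≠ j) (hv : v k ≠ 0) : ∃ c : F, c ≠ 0 ∧ u = c • v := by
  obtain ⟨c, hc, h⟩ := hi
  obtain ⟨d, -, h'⟩ := hj
  have hcd : c = d := mul_right_cancel₀ hv ((h k hki).symm.trans (h' k hkj))
  refine ⟨c, hc, funext fun m => ?_⟩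
  by_cases hm : m = i
  · subst hm; simpa [hcd] using h' m hij
  · exact h m hm

end PropOff

/-- Coordinate vectors of a non-collinear family of points of `ℙ(F^4)`, none of them a coordinate
point, in which the line joining any two points passes through a coordinate point. -/
structure IsCoordClique (P : Set (Fin 4 → F)) : Prop where
  exists_ne : ∀ y ∈ P, ∀ i, ∃ m, m ≠ i ∧ y m ≠ 0
  exists_propOff : ∀ y ∈ P, ∀ z ∈ P, ∃ i, PropOff i y z
  exists_notMem : ∀ u v : Fin 4 → F, ∃ y ∈ P, ∀ a b : F, y ≠ a • u + b • v

lemma exists_fourth_index {i j k : Fin 4} (hij : i ≠ j) (hik : i ≠ k) (hjk : j ≠ k) :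
    ∃ l, l ≠ i ∧ l ≠ j ∧ l ≠ k ∧ ∀ m, m = i ∨ m = j ∨ m = k ∨ m = l := by
  revert i j k; decide

namespace IsCoordClique

variable {P : Set (Fin 4 → F)}

/-- A coordinate clique contains a triangle whose sides pass through three distinct coordinate
points; the whole clique lies in the plane spanned by these. -/
lemma exists_triangle (hP : IsCoordClique P) :
    ∃ y₁ ∈ P, ∃ y₂ ∈ P, ∃ y₃ ∈ P, ∃ i j k l : Fin 4, i ≠ j ∧ i ≠ k ∧ j ≠ k ∧
      l ≠ i ∧ l ≠ j ∧ l ≠ k ∧ (∀ m, m = i ∨ m = j ∨ m = k ∨ m = l) ∧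
      PropOff i y₁ y₂ ∧ PropOff j y₁ y₃ ∧ PropOff k y₂ y₃ ∧
      (∀ m, PropOff m y₁ y₂ → ¬ PropOff m y₁ y₃) ∧ ∀ y ∈ P, y l = 0 := by
  obtain ⟨y₁, h₁, -⟩ := hP.exists_notMem 0 0
  obtain ⟨y₂, h₂, h₁₂⟩ := hP.exists_notMem y₁ 0
  obtain ⟨y₃, h₃, h₁₂₃⟩ := hP.exists_notMem y₁ y₂
  have key : ∀ i, PropOff i y₁ y₂ → ¬ PropOff i y₁ y₃ := fun i h h' => by
    obtain ⟨a, b, hab⟩ := h.exists_eq_combination h' fun c hc => h₁₂ c 0 (by simpa using hc)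
    exact h₁₂₃ a b hab
  obtain ⟨i, hi⟩ := hP.exists_propOff _ h₁ _ h₂
  obtain ⟨j, hj⟩ := hP.exists_propOff _ h₁ _ h₃
  obtain ⟨k, hk⟩ := hP.exists_propOff _ h₂ _ h₃
  have hij : i ≠ j := fun h => key i hi (h ▸ hj)
  have hik : i ≠ k := fun h => key i hi (hi.trans (h ▸ hk))
  have hjk : j ≠ k := by
    rintro rfl
    exact key j (hj.trans hk.symm) hj
  obtain ⟨l, hli, hlj, hlk, hl⟩ := exists_fourth_index hij hik hjk
  have hl₁ : y₁ l = 0 := by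
    obtain ⟨c, hc, hi'⟩ := hi
    obtain ⟨d, hd, hj'⟩ := hj
    obtain ⟨e, he, hk'⟩ := hk
    by_contra h0
    have hl₃ : y₃ l ≠ 0 := fun h => h0 (by rw [hj' l hlj, h, mul_zero])
    have hd' : d = c * e := mul_right_cancel₀ hl₃ (by
      rw [← hj' l hlj, hi' l hli, hk' l hlk, mul_assoc])
    refine h₁₂ c⁻¹ 0 (funext fun m => ?_)
    have hm : y₁ m = c * y₂ m := by
      by_cases hmi : m = i
      · subst hmi
        rw [hj' m hij, hk' m hik, hd', mul_assoc]
      · exact hi' m hmi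
    simp [hm, inv_mul_cancel_left₀ hc]
  have hl₂ : y₂ l = 0 := hi.symm.eq_zero hli hl₁
  have hl₃ : y₃ l = 0 := hj.symm.eq_zero hlj hl₁
  refine ⟨y₁, h₁, y₂, h₂, y₃, h₃, i, j, k, l, hij, hik, hjk, hli, hlj, hlk, hl, hi, hj, hk, key,
    fun y hy => ?_⟩
  by_contra h0
  have hoff : ∀ z ∈ P, z l = 0 → PropOff l y z := fun z hz hzl => by
    obtain ⟨a, ha⟩ := hP.exists_propOff _ hy _ hz
    by_cases hal : l = a
    · exact hal ▸ ha
    · exact absurd (ha.eq_zero hal hzl) h0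
  exact key l ((hoff _ h₁ hl₁).symm.trans (hoff _ h₂ hl₂))
    ((hoff _ h₁ hl₁).symm.trans (hoff _ h₃ hl₃))

/-- No vector of a coordinate clique lies on a line joining two coordinate points. -/
lemma exists_ne_ne (hP : IsCoordClique P) {y : Fin 4 → F} (hy : y ∈ P) {a b : Fin 4}
    (hab : a ≠ b) : ∃ m, m ≠ a ∧ m ≠ b ∧ y m ≠ 0 := by
  by_contra! hm
  obtain ⟨-, -, -, -, -, -, -, -, -, l, -, -, -, -, -, -, -, -, -, -, -, hPl⟩ := hP.exists_triangle
  obtain ⟨m, hmb, hma⟩ := hP.exists_ne y hy b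
  have hya : y a ≠ 0 := by
    by_cases h : m = a
    · exact h ▸ hma
    · exact absurd (hm m h hmb) hma
  obtain ⟨m', hma', hmb'⟩ := hP.exists_ne y hy a
  have hyb : y b ≠ 0 := by
    by_cases h : m' = b
    · exact h ▸ hmb'
    · exact absurd (hm m' hma' h) hmb'
  have hal : a ≠ l := fun h => hya (h ▸ hPl y hy)
  have hbl : b ≠ l := fun h => hyb (h ▸ hPl y hy)
  obtain ⟨k, hka, hkb, hkl, hk⟩ := exists_fourth_index hab hal hbl
  have hdich : ∀ z ∈ P, z k = 0 ∨ PropOff k z y := fun z hz => by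
    obtain ⟨n, hn⟩ := hP.exists_propOff _ hz _ hy
    by_cases hnk : k = n
    · exact Or.inr (hnk ▸ hn)
    · exact Or.inl (hn.eq_zero hnk (hm k hka hkb))
  obtain ⟨z, hz, hz'⟩ := hP.exists_notMem y (Pi.single k 1)
  obtain ⟨w, hw, hw'⟩ := hP.exists_notMem (Pi.single a 1) (Pi.single b 1)
  have hz0 : ¬ PropOff k z y := fun h => by
    obtain ⟨c, d, -, hcd⟩ := h.exists_eq_add_single
    exact hz' c d hcd
  have hzk : z k = 0 := (hdich z hz).resolve_right hz0
  have hwk : w k ≠ 0 := fun h => by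
    refine hw' (w a) (w b) (funext fun m => ?_)
    rcases hk m with rfl | rfl | rfl | rfl
    · simp [hab]
    · simp [hab.symm]
    · simp [hal.symm, hbl.symm, hPl w hw]
    · simp [hka, hkb, h]
  obtain ⟨n, hn⟩ := hP.exists_propOff _ hw _ hz
  by_cases hnk : k = n
  · subst hnk
    exact hz0 (hn.symm.trans ((hdich w hw).resolve_left hwk))
  · exact hwk (hn.eq_zero hnk hzk)

/-- Up to proportionality, a coordinate clique has at most four elements. -/
lemma exists_four (hP : IsCoordClique P) : ∃ y₁ y₂ y₃ y₄ : Fin 4 → F, ∀ y ∈ P,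
    ∃ c : F, c ≠ 0 ∧ (y = c • y₁ ∨ y = c • y₂ ∨ y = c • y₃ ∨ y = c • y₄) := by
  obtain ⟨y₁, h₁, y₂, h₂, y₃, h₃, i, j, k, l, hij, hik, hjk, hli, hlj, hlk, hl, hi, hj, hk, hkey,
    hPl⟩ := hP.exists_triangle
  have hne : ∀ y ∈ P, ∀ m, m ≠ l → y m ≠ 0 := fun y hy m hml h0 => by
    obtain ⟨n, hnm, hnl, hn⟩ := hP.exists_ne_ne hy hml
    obtain ⟨p, hpm, hpl, hpn, hp⟩ := exists_fourth_index hml hnm.symm hnl.symm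
    obtain ⟨q, hqn, hqp, hq⟩ := hP.exists_ne_ne hy hpn.symm
    rcases hp q with rfl | rfl | rfl | rfl
    exacts [hq h0, hq (hPl y hy), hqn rfl, hqp rfl]
  have huniq : ∀ y ∈ P, ∀ z ∈ P, ∀ m n, m ≠ n → m ≠ l → n ≠ l → PropOff m y z → PropOff n y z →
      ∃ c : F, c ≠ 0 ∧ y = c • z := fun y _ z hz m n hmn hml hnl hm hn => by
    obtain ⟨p, hpm, hpn, hpl, -⟩ := exists_fourth_index hmn hml hnl
    exact hm.exists_eq_smul_of_ne hn hmn hpm hpn (hne z hz p hpl)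
  have hoff : ∀ y ∈ P, ∀ z ∈ P, PropOff i y z ∨ PropOff j y z ∨ PropOff k y z :=
    fun y hy z hz => by
    obtain ⟨n, hn⟩ := hP.exists_propOff _ hy _ hz
    rcases hl n with rfl | rfl | rfl | rfl
    · exact Or.inl hn
    · exact Or.inr (Or.inl hn)
    · exact Or.inr (Or.inr hn)
    · obtain ⟨c, hc, rfl⟩ := hn.exists_eq_smul (hPl y hy) (hPl z hz)
      exact Or.inl (.of_smul hc i z)
  have hcase : ∀ y ∈ P,
      (∃ c : F, c ≠ 0 ∧ (y = c • y₁ ∨ y = c • y₂ ∨ y = c • y₃)) ∨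
        (PropOff k y y₁ ∧ PropOff j y y₂) := fun y hy => by
    rcases hoff y hy _ h₁ with h | h | h
    · rcases hoff y hy _ h₃ with h' | h' | h'
      · exact absurd (h.symm.trans h') (hkey i hi)
      · obtain ⟨c, hc, e⟩ := huniq y hy _ h₁ i j hij hli.symm hlj.symm h (h'.trans hj.symm)
        exact Or.inl ⟨c, hc, Or.inl e⟩
      · obtain ⟨c, hc, e⟩ := huniq y hy _ h₂ i k hik hli.symm hlk.symm (h.trans hi)
          (h'.trans hk.symm)
        exact Or.inl ⟨c, hc, Or.inr (Or.inl e)⟩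
    · rcases hoff y hy _ h₂ with h' | h' | h'
      · obtain ⟨c, hc, e⟩ := huniq y hy _ h₁ i j hij hli.symm hlj.symm (h'.trans hi.symm) h
        exact Or.inl ⟨c, hc, Or.inl e⟩
      · exact absurd hj (hkey j (h.symm.trans h'))
      · obtain ⟨c, hc, e⟩ := huniq y hy _ h₃ j k hjk hlj.symm hlk.symm (h.trans hj) (h'.trans hk)
        exact Or.inl ⟨c, hc, Or.inr (Or.inr e)⟩
    · rcases hoff y hy _ h₂ with h' | h' | h'
      · obtain ⟨c, hc, e⟩ := huniq y hy _ h₁ i k hik hli.symm hlk.symm (h'.trans hi.symm) h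
        exact Or.inl ⟨c, hc, Or.inl e⟩
      · exact Or.inr ⟨h, h'⟩
      · have h₁₂ := h.symm.trans h'
        exact absurd (h₁₂.trans hk) (hkey k h₁₂)
  by_cases hex : ∃ y₄ ∈ P, PropOff k y₄ y₁ ∧ PropOff j y₄ y₂
  · obtain ⟨y₄, h₄, hk₄, hj₄⟩ := hex
    refine ⟨y₁, y₂, y₃, y₄, fun y hy => ?_⟩
    rcases hcase y hy with ⟨c, hc, h⟩ | ⟨h, h'⟩
    · exact ⟨c, hc, by tauto⟩
    · obtain ⟨c, hc, e⟩ := huniq y hy _ h₄ j k hjk hlj.symm hlk.symm (h'.trans hj₄.symm)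
        (h.trans hk₄.symm)
      exact ⟨c, hc, by tauto⟩
  · refine ⟨y₁, y₂, y₃, y₃, fun y hy => ?_⟩
    obtain ⟨c, hc, h⟩ := (hcase y hy).resolve_right fun h => hex ⟨y, hy, h⟩
    exact ⟨c, hc, by tauto⟩

end IsCoordClique

section Normals

/-- The hyperplane with normal vector `y`. -/
def normalHyp (y : Fin 4 → F) : Submodule F (Fin 4 → F) :=
  LinearMap.ker (dotProductEquiv F (Fin 4) y)

lemma mem_normalHyp {y x : Fin 4 → F} : x ∈ normalHyp y ↔ y ⬝ᵥ x = 0 := Iff.rfl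

lemma normalHyp_smul {c : F} (hc : c ≠ 0) (y : Fin 4 → F) :
    normalHyp (c • y) = normalHyp y := by
  ext x
  simp [mem_normalHyp, hc]

lemma normalHyp_single (i : Fin 4) : normalHyp (Pi.single i (1 : F)) = coordHyp F 4 i := by
  ext x
  simp [mem_normalHyp, coordHyp]

lemma finrank_normalHyp {y : Fin 4 → F} (hy : y ≠ 0) : finrank F (normalHyp y) = 3 := by
  have h := Module.Dual.finrank_ker_add_one_of_ne_zero (K := F)
    (f := dotProductEquiv F (Fin 4) y) (by simpa using hy)
  rw [Module.finrank_fin_fun] at h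
  exact Nat.succ_injective h

lemma exists_eq_normalHyp {Y : Submodule F (Fin 4 → F)} (hY : finrank F Y = 3) :
    ∃ y : Fin 4 → F, y ≠ 0 ∧ Y = normalHyp y := by
  have hlt : Y < ⊤ := by
    refine lt_top_iff_ne_top.mpr ?_
    rintro rfl
    simp at hY
  obtain ⟨f, hf, hle⟩ := Y.exists_le_ker_of_lt_top hlt
  obtain ⟨y, rfl⟩ := (dotProductEquiv F (Fin 4)).surjective f
  have hy : y ≠ 0 := by
    rintro rfl
    simp at hf
  exact ⟨y, hy, Submodule.eq_of_le_of_finrank_eq hle (hY.trans (finrank_normalHyp hy).symm)⟩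

lemma exists_eq_of_normalHyp_inf_le {u v w : Fin 4 → F}
    (h : normalHyp u ⊓ normalHyp v ≤ normalHyp w) : ∃ a b : F, w = a • u + b • v := by
  have hK : dotProductEquiv F (Fin 4) w ∈ Submodule.span F
      (Set.range ![dotProductEquiv F (Fin 4) u, dotProductEquiv F (Fin 4) v]) := by
    refine mem_span_of_iInf_ker_le_ker fun x hx => h ?_
    rw [Submodule.mem_iInf] at hx
    exact ⟨hx 0, hx 1⟩
  rw [Matrix.range_cons_cons_empty, Submodule.mem_span_pair] at hK
  obtain ⟨a, b, hab⟩ := hK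
  exact ⟨a, b, (dotProductEquiv F (Fin 4)).injective (by simp [← hab])⟩

lemma two_le_finrank_normalHyp_inf (u v : Fin 4 → F) :
    2 ≤ finrank F ↥(normalHyp u ⊓ normalHyp v) := by
  have hge : ∀ y : Fin 4 → F, 3 ≤ finrank F (normalHyp y) := fun y => by
    by_cases hy : y = 0
    · have : normalHyp y = ⊤ := by ext x; simp [mem_normalHyp, hy]
      rw [this, finrank_top, Module.finrank_fin_fun]
      norm_num
    · exact (finrank_normalHyp hy).ge
  have h := Submodule.finrank_sup_add_finrank_inf_eq (normalHyp u) (normalHyp v)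
  have h' := (normalHyp u ⊔ normalHyp v).finrank_le
  rw [Module.finrank_fin_fun] at h'
  have := hge u
  have := hge v
  omega

lemma exists_le_finrank_eq_two {Z : Submodule F (Fin 4 → F)} (hZ : 2 ≤ finrank F Z) :
    ∃ X ≤ Z, finrank F X = 2 := by
  obtain ⟨f, hf⟩ := exists_linearIndependent_of_le_finrank hZ
  refine ⟨Submodule.span F (Set.range (Z.subtype ∘ f)), ?_, ?_⟩
  · rw [Submodule.span_le]
    rintro _ ⟨m, rfl⟩
    exact (f m).2
  · rw [finrank_span_eq_card (hf.map' Z.subtype Z.ker_subtype), Fintype.card_fin]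

lemma finrank_normalHyp_inf {u v : Fin 4 → F} (hu : u ≠ 0) (hv : v ≠ 0)
    (huv : normalHyp u ≠ normalHyp v) : finrank F ↥(normalHyp u ⊓ normalHyp v) = 2 := by
  refine le_antisymm ?_ (two_le_finrank_normalHyp_inf u v)
  by_contra! h
  have hu3 := finrank_normalHyp hu
  have hv3 := finrank_normalHyp hv
  have h1 := Submodule.eq_of_le_of_finrank_le (inf_le_left : normalHyp u ⊓ normalHyp v ≤ _)
    (by omega)
  have h2 := Submodule.eq_of_le_of_finrank_le (inf_le_right : normalHyp u ⊓ normalHyp v ≤ _)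
    (by omega)
  exact huv (h1.symm.trans h2)

end Normals

section Tops

lemma finrank_span_pair_eq_two {p q : Fin 4 → F} (hp : p ≠ 0) (h : q ∉ Submodule.span F {p}) :
    finrank F (Submodule.span F {p, q}) = 2 := by
  have hli : LinearIndependent F ![p, q] := by
    rw [LinearIndependent.pair_iff' hp]
    intro a ha
    exact h (Submodule.mem_span_singleton.mpr ⟨a, ha⟩)
  have := finrank_span_eq_card hli
  rwa [Matrix.range_cons_cons_empty, Fintype.card_fin] at this

lemma isNondeg_of_one_mem {A : Submodule F (Fin 4 → F)} (h : (1 : Fin 4 → F) ∈ A) :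
    IsNondeg F 4 A := by
  rintro ⟨i, hi⟩
  simpa [coordHyp] using hi h

/-- Every plane is adjacent to some non-degenerate plane. -/
lemma exists_adjK_isNondeg {A : Submodule F (Fin 4 → F)} (hA : finrank F A = 2) :
    ∃ B : Submodule F (Fin 4 → F), finrank F B = 2 ∧ IsNondeg F 4 B ∧ AdjK F 4 2 A B := by
  obtain ⟨p, q, hp, hpA, hqA, h1⟩ : ∃ p q : Fin 4 → F, p ≠ 0 ∧ p ∈ A ∧ q ∉ A ∧ (p = 1 ∨ q = 1) := by
    by_cases h1 : (1 : Fin 4 → F) ∈ A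
    · obtain ⟨q, hq⟩ := SetLike.exists_not_mem_of_ne_top A (by rintro rfl; simp at hA)
      exact ⟨1, q, one_ne_zero, h1, hq, Or.inl rfl⟩
    · obtain ⟨p, hpA, hp⟩ := A.exists_mem_ne_zero_of_ne_bot (by rintro rfl; simp at hA)
      exact ⟨p, 1, hp, hpA, h1, Or.inr rfl⟩
  have hpB : p ∈ Submodule.span F {p, q} := Submodule.subset_span (by simp)
  have hqB : q ∈ Submodule.span F {p, q} := Submodule.subset_span (by simp)
  have hB : finrank F (Submodule.span F {p, q}) = 2 := finrank_span_pair_eq_two hp fun h => by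
    obtain ⟨a, rfl⟩ := Submodule.mem_span_singleton.mp h
    exact hqA (A.smul_mem a hpA)
  have hne : A ≠ Submodule.span F {p, q} := fun h => hqA (h ▸ hqB)
  refine ⟨_, hB, isNondeg_of_one_mem (by rcases h1 with rfl | rfl <;> assumption), hne, ?_⟩
  have hlt : A ⊓ Submodule.span F {p, q} < A :=
    inf_le_left.lt_of_ne fun h => hne
      (Submodule.eq_of_le_of_finrank_eq (inf_eq_left.mp h) (hA.trans hB.symm))
  have h2 := Submodule.finrank_lt_finrank_of_lt hlt
  have h3 : finrank F ↥(A ⊓ Submodule.span F {p, q}) ≠ 0 := fun h => by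
    rw [Submodule.finrank_eq_zero] at h
    exact hp ((Submodule.mem_bot F).mp (h ▸ ⟨hpA, hpB⟩))
  omega

lemma exists_isNondeg : ∃ A : Submodule F (Fin 4 → F), finrank F A = 2 ∧ IsNondeg F 4 A := by
  obtain ⟨X, -, hX⟩ := exists_le_finrank_eq_two (Z := (⊤ : Submodule F (Fin 4 → F))) (by simp)
  obtain ⟨B, hB, hB', -⟩ := exists_adjK_isNondeg hX
  exact ⟨B, hB, hB'⟩

lemma IsMaxCliqueD.nonempty {C : Set (Submodule F (Fin 4 → F))} (hC : IsMaxCliqueD F 4 2 C) :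
    C.Nonempty := by
  rw [Set.nonempty_iff_ne_empty]
  rintro rfl
  obtain ⟨A, hA, hA'⟩ := exists_isNondeg (F := F)
  refine Set.singleton_ne_empty A (hC.2 {A} ⟨?_, ?_⟩ (Set.empty_subset _))
  · rintro _ rfl
    exact ⟨hA, hA'⟩
  · rintro _ rfl _ rfl h
    exact absurd rfl h

lemma IsMaxCliqueD.ne_singleton {C : Set (Submodule F (Fin 4 → F))} (hC : IsMaxCliqueD F 4 2 C)
    (A : Submodule F (Fin 4 → F)) : C ≠ {A} := by
  rintro rfl
  obtain ⟨hA, hA'⟩ := hC.1.1 A rfl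
  obtain ⟨B, hB, hB', hAB⟩ := exists_adjK_isNondeg hA
  have hBA : AdjK F 4 2 B A := ⟨hAB.1.symm, by rw [inf_comm]; exact hAB.2⟩
  have h := hC.2 {A, B} ⟨?_, ?_⟩ (by simp)
  · have hmem : B ∈ ({A, B} : Set (Submodule F (Fin 4 → F))) := by simp
    rw [h] at hmem
    exact hAB.1 hmem.symm
  · rintro _ (rfl | rfl)
    exacts [⟨hA, hA'⟩, ⟨hB, hB'⟩]
  · rintro _ (rfl | rfl) _ (rfl | rfl) hne
    exacts [absurd rfl hne, hAB, hBA, absurd rfl hne]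

lemma isNondeg_of_isMaxCliqueD_Tc {Y : Submodule F (Fin 4 → F)}
    (hY : IsMaxCliqueD F 4 2 (Tc F 4 2 Y)) : IsNondeg F 4 Y := by
  rintro ⟨i, hi⟩
  obtain ⟨A, -, hAY, hA⟩ := hY.nonempty
  exact hA ⟨i, hAY.trans hi⟩

lemma isDeg_inf_of_isCliqueDt' {𝒳 : Set (Set (Submodule F (Fin 4 → F)))}
    (h𝒳 : IsCliqueDt' F 4 2 𝒳) {u v : Fin 4 → F} (hu : u ≠ 0) (hv : v ≠ 0)
    (hu' : Tc F 4 2 (normalHyp u) ∈ 𝒳) (hv' : Tc F 4 2 (normalHyp v) ∈ 𝒳)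
    (huv : normalHyp u ≠ normalHyp v) : IsDeg F 4 (normalHyp u ⊓ normalHyp v) := by
  have h2 := finrank_normalHyp_inf hu hv huv
  by_contra hnd
  have hmem : normalHyp u ⊓ normalHyp v ∈ Tc F 4 2 (normalHyp u) ∩ Tc F 4 2 (normalHyp v) :=
    ⟨⟨h2, inf_le_left, hnd⟩, ⟨h2, inf_le_right, hnd⟩⟩
  by_cases hT : Tc F 4 2 (normalHyp u) = Tc F 4 2 (normalHyp v)
  · refine (h𝒳.1 _ hu').2.ne_singleton (normalHyp u ⊓ normalHyp v) ?_
    refine Set.eq_singleton_iff_unique_mem.mpr ⟨hmem.1, fun A hA => ?_⟩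
    exact Submodule.eq_of_le_of_finrank_eq (le_inf hA.2.1 (hT ▸ hA).2.1) (hA.1.trans h2.symm)
  · have h := (h𝒳.2 _ hu' _ hv' hT).2
    exact (h ▸ hmem : _ ∈ (∅ : Set (Submodule F (Fin 4 → F))))

end Tops

lemma isNondeg_normalHyp_exists_ne {y : Fin 4 → F} (hy : y ≠ 0) (hY : IsNondeg F 4 (normalHyp y))
    (i : Fin 4) : ∃ m, m ≠ i ∧ y m ≠ 0 := by
  by_contra! h
  have hy' : y = y i • Pi.single i 1 := funext fun m => by
    by_cases hm : m = i
    · subst hm; simp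
    · simp [hm, h m hm]
  have hyi : y i ≠ 0 := fun h0 => hy (by rw [hy', h0, zero_smul])
  refine hY ⟨i, ?_⟩
  rw [hy', normalHyp_smul hyi, normalHyp_single]

lemma propOff_of_isDeg_inf {u v : Fin 4 → F}
    (hu : IsNondeg F 4 (normalHyp u)) (hv : IsNondeg F 4 (normalHyp v))
    (huv : IsDeg F 4 (normalHyp u ⊓ normalHyp v)) : ∃ i, PropOff i u v := by
  obtain ⟨i, hi⟩ := huv
  rw [← normalHyp_single] at hi
  obtain ⟨a, b, hab⟩ := exists_eq_of_normalHyp_inf_le hi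
  have hle : ∀ (c : F) (y : Fin 4 → F), Pi.single i 1 = c • y → IsDeg F 4 (normalHyp y) :=
    fun c y h => ⟨i, fun x hx => by
      rw [← normalHyp_single, h, mem_normalHyp, smul_dotProduct, mem_normalHyp.mp hx, smul_zero]⟩
  have ha : a ≠ 0 := by
    rintro rfl
    exact hv (hle b v (by simpa using hab))
  have hb : b ≠ 0 := by
    rintro rfl
    exact hu (hle a u (by simpa using hab))
  refine ⟨i, -(b / a), neg_ne_zero.mpr (div_ne_zero hb ha), fun m hm => ?_⟩
  have h := congrFun hab m
  simp only [Pi.single_eq_of_ne hm, Pi.add_apply, Pi.smul_apply, smul_eq_mul] at h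
  field_simp
  linear_combination -h

/-- The normal vectors of a non-linear clique of `Δ'_t` form a coordinate clique. -/
lemma isCoordClique_normals {𝒳 : Set (Set (Submodule F (Fin 4 → F)))}
    (h𝒳 : IsCliqueDt' F 4 2 𝒳)
    (hnl : ¬ ∃ X : Submodule F (Fin 4 → F), finrank F ↥X = 2 ∧
        ∀ Y : Submodule F (Fin 4 → F), finrank F ↥Y = 3 → Tc F 4 2 Y ∈ 𝒳 → X ≤ Y) :
    IsCoordClique {y : Fin 4 → F | y ≠ 0 ∧ Tc F 4 2 (normalHyp y) ∈ 𝒳} where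
  exists_ne y hy i :=
    isNondeg_normalHyp_exists_ne hy.1 (isNondeg_of_isMaxCliqueD_Tc (h𝒳.1 _ hy.2).2) i
  exists_propOff y hy z hz := by
    by_cases h : normalHyp y = normalHyp z
    · obtain ⟨a, b, hab⟩ := exists_eq_of_normalHyp_inf_le (inf_le_left.trans h.ge :
        normalHyp z ⊓ normalHyp z ≤ normalHyp y)
      rw [← add_smul] at hab
      have hc : a + b ≠ 0 := fun h0 => hy.1 (by rw [hab, h0, zero_smul])
      exact ⟨0, hab ▸ .of_smul hc 0 z⟩
    · exact propOff_of_isDeg_inf (isNondeg_of_isMaxCliqueD_Tc (h𝒳.1 _ hy.2).2)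
        (isNondeg_of_isMaxCliqueD_Tc (h𝒳.1 _ hz.2).2)
        (isDeg_inf_of_isCliqueDt' h𝒳 hy.1 hz.1 hy.2 hz.2 h)
  exists_notMem u v := by
    by_contra! hall
    obtain ⟨X, hXle, hX⟩ := exists_le_finrank_eq_two (two_le_finrank_normalHyp_inf u v)
    refine hnl ⟨X, hX, fun Y hY hYX x hx => ?_⟩
    obtain ⟨y, hy, rfl⟩ := exists_eq_normalHyp hY
    obtain ⟨a, b, rfl⟩ := hall y ⟨hy, hYX⟩
    obtain ⟨hxu, hxv⟩ := hXle hx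
    rw [SetLike.mem_coe, mem_normalHyp] at hxu hxv
    simp [mem_normalHyp, hxu, hxv]

end CoordinateCliques

/-- for `|F| ≥ 3`, `n = 4`, `k = 2`, every non-linear maximal clique `𝒳`
of `Δ'_t` satisfies: (1) some standard coordinate line is contained in every `Y` with
`T^c(Y) ∈ 𝒳`; (2) `𝒳` has at most four elements; (3) no `Y` with `T^c(Y) ∈ 𝒳` contains
an intersection `C_i ∩ C_j` of two distinct coordinate hyperplanes. -/
theorem stmt15 (F : Type*) [Field F] (hF : (3 : Cardinal) ≤ Cardinal.mk F)
    (𝒳 : Set (Set (Submodule F (Fin 4 → F))))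
    (h𝒳 : IsMaxCliqueDt' F 4 2 𝒳)
    (hnl : ¬ ∃ X : Submodule F (Fin 4 → F), finrank F ↥X = 2 ∧
        ∀ Y : Submodule F (Fin 4 → F), finrank F ↥Y = 3 → Tc F 4 2 Y ∈ 𝒳 → X ≤ Y) :
    (∃ j : Fin 4, ∀ Y : Submodule F (Fin 4 → F), finrank F ↥Y = 3 → Tc F 4 2 Y ∈ 𝒳 →
        Submodule.span F {Pi.single j (1 : F)} ≤ Y) ∧
    (∃ a b c d : Set (Submodule F (Fin 4 → F)), 𝒳 ⊆ {a, b, c, d}) ∧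
    (∀ i j : Fin 4, i ≠ j → ∀ Y : Submodule F (Fin 4 → F), finrank F ↥Y = 3 →
        Tc F 4 2 Y ∈ 𝒳 → ¬ (coordHyp F 4 i ⊓ coordHyp F 4 j ≤ Y)) := by
  have hP := isCoordClique_normals h𝒳.1 hnl
  refine ⟨?_, ?_, ?_⟩
  · obtain ⟨-, -, -, -, -, -, -, -, -, l, -, -, -, -, -, -, -, -, -, -, -, hPl⟩ := hP.exists_triangle
    refine ⟨l, fun Y hY hYX => ?_⟩
    obtain ⟨y, hy, rfl⟩ := exists_eq_normalHyp hY
    rw [Submodule.span_singleton_le_iff_mem, mem_normalHyp, dotProduct_single, mul_one]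
    exact hPl y ⟨hy, hYX⟩
  · obtain ⟨y₁, y₂, y₃, y₄, h⟩ := hP.exists_four
    refine ⟨Tc F 4 2 (normalHyp y₁), Tc F 4 2 (normalHyp y₂), Tc F 4 2 (normalHyp y₃),
      Tc F 4 2 (normalHyp y₄), fun T hT => ?_⟩
    obtain ⟨Y, hY, rfl⟩ := (h𝒳.1.1 T hT).1
    obtain ⟨y, hy, rfl⟩ := exists_eq_normalHyp hY
    obtain ⟨c, hc, rfl | rfl | rfl | rfl⟩ := h y ⟨hy, hT⟩ <;> simp [normalHyp_smul hc]
  · intro i j hij Y hY hYX hle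
    obtain ⟨y, hy, rfl⟩ := exists_eq_normalHyp hY
    obtain ⟨m, hmi, hmj, hm⟩ := hP.exists_ne_ne ⟨hy, hYX⟩ hij
    have hmem : Pi.single m (1 : F) ∈ normalHyp y :=
      hle ⟨by simp [coordHyp, hmi.symm], by simp [coordHyp, hmj.symm]⟩
    rw [mem_normalHyp, dotProduct_single, mul_one] at hmem
    exact hm hmem
end

section
/- Let F be a field with at least 6 elements, n = 4 and k = 2. Then a maximal clique 𝒳 of Δ'_t is linear, i.e., 𝒳 = {T^c(Y) : Y a non-degenerate 3-dimensional subspace of F^4 with X ⊆ Y} for some degenerate 2-dimensional subspace X, if and only if 𝒳 contains at least five elements. -/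
open Module

section TopsOfCoordinateSpace

variable {F : Type*} [Field F]

/-- A subspace contained in none of finitely many subspaces is not covered by them, provided the
field has at least as many elements as there are subspaces. -/
lemma exists_mem_forall_notMem_of_card_le {V ι : Type*} [AddCommGroup V] [Module F V]
    [DecidableEq ι] (T : Finset F) (p : ι → Submodule F V) (Y : Submodule F V) (s : Finset ι)
    (hs : s.card ≤ T.card) (h : ∀ i ∈ s, ¬ Y ≤ p i) : ∃ v ∈ Y, ∀ i ∈ s, v ∉ p i := by
  induction s using Finset.induction_on with
  | empty => exact ⟨0, Y.zero_mem, by simp⟩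
  | insert a s ha ih =>
    rw [Finset.card_insert_of_notMem ha] at hs
    obtain ⟨v, hvY, hv⟩ := ih (by omega) fun i hi => h i (Finset.mem_insert_of_mem hi)
    by_cases hva : v ∈ p a
    · obtain ⟨w, hwY, hwa⟩ := SetLike.not_le_iff_exists.mp (h a (Finset.mem_insert_self a s))
      obtain ⟨t, -, ht⟩ : ∃ t ∈ T, ∀ i ∈ s, w + t • v ∉ p i := by
        by_contra! hcon
        have : Nonempty ι := ⟨a⟩
        choose! g hgs hg using hcon
        obtain ⟨x, hx, y, hy, hxy, hgxy⟩ :=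
          Finset.exists_ne_map_eq_of_card_lt_of_maps_to (by omega : s.card < T.card)
            fun x hx => hgs x hx
        have h1 := (p (g x)).sub_mem (hg x hx) (hgxy ▸ hg y hy)
        rw [add_sub_add_left_eq_sub, ← sub_smul,
          Submodule.smul_mem_iff _ (sub_ne_zero.mpr hxy)] at h1
        exact hv _ (hgs x hx) h1
      refine ⟨w + t • v, Y.add_mem hwY (Y.smul_mem t hvY), fun i hi => ?_⟩
      rcases Finset.mem_insert.mp hi with rfl | hi
      · rwa [Submodule.add_mem_iff_left _ (Submodule.smul_mem _ t hva)]
      · exact ht i hi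
    · refine ⟨v, hvY, fun i hi => ?_⟩
      rcases Finset.mem_insert.mp hi with rfl | hi
      · exact hva
      · exact hv i hi

lemma finrank_sup_span_singleton_of_notMem {V : Type*} [AddCommGroup V] [Module F V]
    [FiniteDimensional F V] {L : Submodule F V} {v : V} (hv : v ∉ L) :
    finrank F ↥(L ⊔ Submodule.span F {v}) = finrank F L + 1 := by
  have h0 : v ≠ 0 := fun h => hv (h ▸ L.zero_mem)
  have hd : L ⊓ Submodule.span F {v} = ⊥ :=
    ((Submodule.disjoint_span_singleton' h0).mpr hv).eq_bot
  have h := Submodule.finrank_sup_add_finrank_inf_eq L (Submodule.span F {v})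
  rw [hd, finrank_bot, finrank_span_singleton h0] at h
  exact h

lemma finrank_inf_add_one {V : Type*} [AddCommGroup V] [Module F V] [FiniteDimensional F V]
    {W H : Submodule F V} (hH : finrank F H + 1 = finrank F V) (h : ¬ W ≤ H) :
    finrank F ↥(W ⊓ H) + 1 = finrank F W := by
  have h1 := Submodule.finrank_sup_add_finrank_inf_eq W H
  have h2 : finrank F H < finrank F ↥(W ⊔ H) := Submodule.finrank_lt_finrank_of_lt (by simpa)
  have h3 := Submodule.finrank_le (W ⊔ H)
  omega

lemma finrank_inf_eq_one {V : Type*} [AddCommGroup V] [Module F V] [FiniteDimensional F V]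
    {A B Y : Submodule F V} (hA : finrank F A = 2) (hB : finrank F B = 2) (hY : finrank F Y = 3)
    (hAY : A ≤ Y) (hBY : B ≤ Y) (hAB : A ≠ B) : finrank F ↥(A ⊓ B) = 1 := by
  have h1 := Submodule.finrank_sup_add_finrank_inf_eq A B
  have h2 : finrank F B < finrank F ↥(A ⊔ B) := by
    refine Submodule.finrank_lt_finrank_of_lt ?_
    rw [right_lt_sup]
    exact fun h => hAB (Submodule.eq_of_le_of_finrank_eq h (hA.trans hB.symm))
  have h3 := Submodule.finrank_mono (sup_le hAY hBY)
  omega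

lemma finrank_coordHyp (i : Fin 4) : finrank F (coordHyp F 4 i) = 3 := by
  have h := LinearMap.finrank_range_add_finrank_ker
    (LinearMap.proj (R := F) (φ := fun _ : Fin 4 => F) i)
  rw [LinearMap.range_eq_top.mpr (LinearMap.proj_surjective i), finrank_top] at h
  change finrank F F + finrank F (coordHyp F 4 i) = finrank F (Fin 4 → F) at h
  rw [finrank_self, finrank_fin_fun] at h
  omega

lemma finrank_inf_of_not_le {W H : Submodule F (Fin 4 → F)} (hH : finrank F H = 3)
    (h : ¬ W ≤ H) : finrank F ↥(W ⊓ H) + 1 = finrank F W :=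
  finrank_inf_add_one (by simp [hH]) h

lemma finrank_inf_of_ne {Y Z : Submodule F (Fin 4 → F)} (hY : finrank F Y = 3)
    (hZ : finrank F Z = 3) (h : Y ≠ Z) : finrank F ↥(Y ⊓ Z) = 2 := by
  have := finrank_inf_of_not_le hZ
    fun hle => h (Submodule.eq_of_le_of_finrank_eq hle (hY.trans hZ.symm))
  omega

lemma finrank_inf_coordHyp {Y : Submodule F (Fin 4 → F)} (hY : finrank F Y = 3)
    (hn : IsNondeg F 4 Y) (i : Fin 4) : finrank F ↥(Y ⊓ coordHyp F 4 i) = 2 := by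
  have := finrank_inf_of_not_le (finrank_coordHyp i) fun hle => hn ⟨i, hle⟩
  omega

lemma eq_bot_of_forall_le_coordHyp {X : Submodule F (Fin 4 → F)}
    (h : ∀ i, X ≤ coordHyp F 4 i) : X = ⊥ := by
  rw [Submodule.eq_bot_iff]
  intro x hx
  ext i
  exact h i hx

lemma isNondeg_of_mem {A : Submodule F (Fin 4 → F)} {v : Fin 4 → F} (hv : v ∈ A)
    (h : ∀ i, v ∉ coordHyp F 4 i) : IsNondeg F 4 A :=
  fun ⟨i, hi⟩ => h i (hi hv)

lemma exists_mem_forall_notMem_coordHyp (hF : (6 : Cardinal) ≤ Cardinal.mk F)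
    {Y L : Submodule F (Fin 4 → F)} (hn : IsNondeg F 4 Y) (hL : ¬ Y ≤ L) :
    ∃ v ∈ Y, v ∉ L ∧ ∀ i, v ∉ coordHyp F 4 i := by
  obtain ⟨T, hT⟩ := Cardinal.exists_finset_le_card F 6 (by exact_mod_cast hF)
  obtain ⟨v, hv, h⟩ := exists_mem_forall_notMem_of_card_le T
    (fun o : Option (Fin 4) => o.elim L (coordHyp F 4)) Y Finset.univ
    (by simp only [Finset.card_univ, Fintype.card_option, Fintype.card_fin]; omega) (by
      rintro (_ | i) -
      · exact hL
      · exact fun h => hn ⟨i, h⟩)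
  exact ⟨v, hv, h none (Finset.mem_univ _), fun i => h (some i) (Finset.mem_univ _)⟩

lemma exists_mem_Tc_le (hF : (6 : Cardinal) ≤ Cardinal.mk F) {Y L : Submodule F (Fin 4 → F)}
    (hn : IsNondeg F 4 Y) (hY : 2 ≤ finrank F Y) (hL : finrank F L = 1) (hLY : L ≤ Y) :
    ∃ A ∈ Tc F 4 2 Y, L ≤ A := by
  obtain ⟨v, hvY, hvL, hv⟩ := exists_mem_forall_notMem_coordHyp hF hn
    (fun h : Y ≤ L => by have := Submodule.finrank_mono h; omega)
  refine ⟨L ⊔ Submodule.span F {v}, ⟨?_, ?_, ?_⟩, le_sup_left⟩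
  · rw [finrank_sup_span_singleton_of_notMem hvL, hL]
  · exact sup_le hLY ((Submodule.span_singleton_le_iff_mem _ _).mpr hvY)
  · exact isNondeg_of_mem (Submodule.mem_sup_right (Submodule.mem_span_singleton_self v)) hv

lemma Tc_nonempty (hF : (6 : Cardinal) ≤ Cardinal.mk F) {Y : Submodule F (Fin 4 → F)}
    (hn : IsNondeg F 4 Y) (hY : 2 ≤ finrank F Y) : (Tc F 4 2 Y).Nonempty := by
  obtain ⟨v, hvY, hv0, -⟩ := exists_mem_forall_notMem_coordHyp hF hn (L := ⊥)
    (fun h => by have := Submodule.finrank_mono h; rw [finrank_bot] at this; omega)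
  obtain ⟨A, hA, -⟩ := exists_mem_Tc_le hF hn hY (finrank_span_singleton (K := F) hv0)
    ((Submodule.span_singleton_le_iff_mem _ _).mpr hvY)
  exact ⟨A, hA⟩

lemma exists_mem_Tc_not_le (hF : (6 : Cardinal) ≤ Cardinal.mk F)
    {Y L : Submodule F (Fin 4 → F)} (hn : IsNondeg F 4 Y) (hY : finrank F Y = 3)
    (hL : finrank F L = 1) : ∃ A ∈ Tc F 4 2 Y, ¬ L ≤ A := by
  obtain ⟨v, hvY, hvL, hv⟩ := exists_mem_forall_notMem_coordHyp hF hn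
    (fun h : Y ≤ L => by have := Submodule.finrank_mono h; omega)
  have h2 : finrank F ↥(L ⊔ Submodule.span F {v}) = 2 := by
    rw [finrank_sup_span_singleton_of_notMem hvL, hL]
  obtain ⟨w, hwY, hw⟩ := SetLike.not_le_iff_exists.mp
    (fun h : Y ≤ L ⊔ Submodule.span F {v} => by have := Submodule.finrank_mono h; omega)
  have hv0 : v ≠ 0 := fun h => hvL (h ▸ L.zero_mem)
  have hA : finrank F ↥(Submodule.span F {v} ⊔ Submodule.span F {w}) = 2 := by
    rw [finrank_sup_span_singleton_of_notMem fun h => hw (Submodule.mem_sup_right h),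
      finrank_span_singleton hv0]
  refine ⟨_, ⟨hA, ?_, ?_⟩, fun hle => hw ?_⟩
  · exact sup_le ((Submodule.span_singleton_le_iff_mem _ _).mpr hvY)
      ((Submodule.span_singleton_le_iff_mem _ _).mpr hwY)
  · exact isNondeg_of_mem (Submodule.mem_sup_left (Submodule.mem_span_singleton_self v)) hv
  · rw [Submodule.eq_of_le_of_finrank_eq (sup_le hle le_sup_left) (h2.trans hA.symm)]
    exact Submodule.mem_sup_right (Submodule.mem_span_singleton_self w)

lemma isTopD_Tc (hF : (6 : Cardinal) ≤ Cardinal.mk F) {Y : Submodule F (Fin 4 → F)}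
    (hn : IsNondeg F 4 Y) (hY : finrank F Y = 3) : IsTopD F 4 2 (Tc F 4 2 Y) := by
  refine ⟨⟨Y, hY, rfl⟩, ⟨fun A hA => ⟨hA.1, hA.2.2⟩, fun A hA B hB hAB =>
    ⟨hAB, finrank_inf_eq_one hA.1 hB.1 hY hA.2.1 hB.2.1 hAB⟩⟩, fun D hD hsub => ?_⟩
  refine subset_antisymm (fun B hB => ⟨(hD.1 B hB).1, ?_, (hD.1 B hB).2⟩) hsub
  by_contra hBY
  have hL := finrank_inf_of_not_le hY hBY
  rw [(hD.1 B hB).1] at hL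
  obtain ⟨A, hA, hLA⟩ := exists_mem_Tc_not_le hF hn hY (by omega : finrank F ↥(B ⊓ Y) = 1)
  have hAB : A ≠ B := fun h => hBY (h ▸ hA.2.1)
  have h1 := (hD.2 A (hsub hA) B hB hAB).2
  have heq : A ⊓ B = B ⊓ Y := Submodule.eq_of_le_of_finrank_eq
    (le_inf inf_le_right (inf_le_left.trans hA.2.1)) (by omega)
  exact hLA (heq ▸ inf_le_left)

lemma isNondeg_of_isTopD_Tc (hF : (6 : Cardinal) ≤ Cardinal.mk F) {Y : Submodule F (Fin 4 → F)}
    (h : IsTopD F 4 2 (Tc F 4 2 Y)) : IsNondeg F 4 Y := by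
  rintro ⟨i, hi⟩
  have hempty : Tc F 4 2 Y = ∅ :=
    Set.eq_empty_iff_forall_notMem.mpr fun A hA => hA.2.2 ⟨i, hA.2.1.trans hi⟩
  have htop : IsNondeg F 4 (⊤ : Submodule F (Fin 4 → F)) := by
    rintro ⟨j, hj⟩
    have := Submodule.finrank_mono hj
    rw [finrank_coordHyp, finrank_top, finrank_fin_fun] at this
    omega
  obtain ⟨A, hA⟩ := Tc_nonempty hF htop (by rw [finrank_top, finrank_fin_fun]; norm_num)
  have := h.2.2 {A} ⟨by rintro _ rfl; exact ⟨hA.1, hA.2.2⟩,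
    by rintro _ rfl _ rfl h; exact absurd rfl h⟩ (by simp [hempty])
  simp [hempty] at this

lemma Tc_inter_Tc_eq_empty {Y Z : Submodule F (Fin 4 → F)} (h : IsDeg F 4 (Y ⊓ Z)) :
    Tc F 4 2 Y ∩ Tc F 4 2 Z = ∅ := by
  obtain ⟨i, hi⟩ := h
  exact Set.eq_empty_iff_forall_notMem.mpr
    fun A hA => hA.1.2.2 ⟨i, (le_inf hA.1.2.1 hA.2.2.1).trans hi⟩

lemma Tc_ne_Tc (hF : (6 : Cardinal) ≤ Cardinal.mk F) {Y Z : Submodule F (Fin 4 → F)}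
    (hn : IsNondeg F 4 Y) (hY : finrank F Y = 3) (h : IsDeg F 4 (Y ⊓ Z)) :
    Tc F 4 2 Y ≠ Tc F 4 2 Z := by
  intro heq
  have h0 := Tc_inter_Tc_eq_empty h
  rw [← heq, Set.inter_self] at h0
  exact (Tc_nonempty hF hn (by omega)).ne_empty h0

lemma exists_adjK_of_mem_Tc (hF : (6 : Cardinal) ≤ Cardinal.mk F)
    {X Y Z A : Submodule F (Fin 4 → F)} (hX : finrank F X = 2) (hXd : IsDeg F 4 X)
    (hY : finrank F Y = 3) (hZ : finrank F Z = 3) (hZn : IsNondeg F 4 Z) (hXY : X ≤ Y)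
    (hXZ : X ≤ Z) (hYZ : Y ≠ Z) (hA : A ∈ Tc F 4 2 Y) : ∃ B ∈ Tc F 4 2 Z, AdjK F 4 2 A B := by
  have hAX : A ≠ X := fun h => hA.2.2 (h ▸ hXd)
  obtain ⟨B, hB, hle⟩ := exists_mem_Tc_le hF hZn (by omega)
    (finrank_inf_eq_one hA.1 hX hY hA.2.1 hXY hAX) (inf_le_right.trans hXZ)
  have hXeq : X = Y ⊓ Z := Submodule.eq_of_le_of_finrank_eq (le_inf hXY hXZ)
    (by rw [hX, finrank_inf_of_ne hY hZ hYZ])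
  have heq : A ⊓ B = A ⊓ X := le_antisymm
    (le_inf inf_le_left (hXeq ▸ inf_le_inf hA.2.1 hB.2.1)) (le_inf inf_le_left hle)
  refine ⟨B, hB, fun h => hAX ?_, ?_⟩
  · refine Submodule.eq_of_le_of_finrank_eq ?_ (hA.1.trans hX.symm)
    rw [hXeq]
    exact le_inf hA.2.1 (h ▸ hB.2.1)
  · rw [heq, finrank_inf_eq_one hA.1 hX hY hA.2.1 hXY hAX]

lemma isCliqueDt'_topsThrough (hF : (6 : Cardinal) ≤ Cardinal.mk F)
    {X : Submodule F (Fin 4 → F)} (hX : finrank F X = 2) (hXd : IsDeg F 4 X) :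
    IsCliqueDt' F 4 2 (TopsThrough F 4 2 X) := by
  constructor
  · rintro _ ⟨Y, hY, hn, -, rfl⟩
    exact isTopD_Tc hF hn hY
  · rintro _ ⟨Y, hY, hYn, hXY, rfl⟩ _ ⟨Z, hZ, hZn, hXZ, rfl⟩ hne
    have hYZ : Y ≠ Z := fun h => hne (h ▸ rfl)
    have hXeq : X = Y ⊓ Z := Submodule.eq_of_le_of_finrank_eq (le_inf hXY hXZ)
      (by rw [hX, finrank_inf_of_ne hY hZ hYZ])
    exact ⟨⟨hne, fun A hA => exists_adjK_of_mem_Tc hF hX hXd hY hZ hZn hXY hXZ hYZ hA,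
      fun A hA => exists_adjK_of_mem_Tc hF hX hXd hZ hY hYn hXZ hXY hYZ.symm hA⟩,
      Tc_inter_Tc_eq_empty (hXeq ▸ hXd)⟩

lemma exists_five_topsThrough (hF : (6 : Cardinal) ≤ Cardinal.mk F)
    {X : Submodule F (Fin 4 → F)} (hX : finrank F X = 2) (hXd : IsDeg F 4 X) :
    ∃ s : Finset (Set (Submodule F (Fin 4 → F))), 5 ≤ s.card ∧ ↑s ⊆ TopsThrough F 4 2 X := by
  classical
  obtain ⟨i, hi⟩ := hXd
  obtain ⟨v, hvi, hvX⟩ := SetLike.not_le_iff_exists.mp (fun h : coordHyp F 4 i ≤ X => by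
    have := Submodule.finrank_mono h
    rw [finrank_coordHyp] at this
    omega)
  obtain ⟨u, -, hu⟩ := SetLike.not_le_iff_exists.mp (fun h : ⊤ ≤ coordHyp F 4 i => by
    have := Submodule.finrank_mono h
    rw [finrank_coordHyp, finrank_top, finrank_fin_fun] at this
    omega)
  set Y : F → Submodule F (Fin 4 → F) := fun t => X ⊔ Submodule.span F {u + t • v} with hYdef
  have hui (t : F) : u + t • v ∉ coordHyp F 4 i := by
    rwa [Submodule.add_mem_iff_left _ (Submodule.smul_mem _ t hvi)]
  have hmem (t : F) : u + t • v ∈ Y t :=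
    Submodule.mem_sup_right (Submodule.mem_span_singleton_self _)
  have hXY (t : F) : X ≤ Y t := le_sup_left
  have hY (t : F) : finrank F (Y t) = 3 := by
    rw [hYdef, finrank_sup_span_singleton_of_notMem fun h => hui t (hi h), hX]
  have hinj : Function.Injective Y := by
    intro t s hts
    by_contra hne
    have h1 := (Y t).sub_mem (hmem t) (hts ▸ hmem s)
    rw [add_sub_add_left_eq_sub, ← sub_smul,
      Submodule.smul_mem_iff _ (sub_ne_zero.mpr hne)] at h1
    have h3 : X ⊔ Submodule.span F {v} = Y t := Submodule.eq_of_le_of_finrank_eq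
      (sup_le (hXY t) ((Submodule.span_singleton_le_iff_mem _ _).mpr h1))
      (by rw [finrank_sup_span_singleton_of_notMem hvX, hX, hY])
    have h4 : Y t ≤ coordHyp F 4 i :=
      h3 ▸ sup_le hi ((Submodule.span_singleton_le_iff_mem _ _).mpr hvi)
    exact hui t (h4 (hmem t))
  have hdeg (t s : F) (ht : IsDeg F 4 (Y t)) (hs : IsDeg F 4 (Y s)) : t = s := by
    obtain ⟨j, hj⟩ := ht
    obtain ⟨k, hk⟩ := hs
    have hji : i ≠ j := by rintro rfl; exact hui t (hj (hmem t))
    have hki : i ≠ k := by rintro rfl; exact hui s (hk (hmem s))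
    by_cases hjk : j = k
    · subst hjk
      apply hinj
      rw [Submodule.eq_of_le_of_finrank_eq hj (by rw [hY, finrank_coordHyp]),
        Submodule.eq_of_le_of_finrank_eq hk (by rw [hY, finrank_coordHyp])]
    · exfalso
      obtain ⟨l, hl⟩ : ∃ l : Fin 4, ∀ m, m = i ∨ m = j ∨ m = k ∨ m = l := by
        clear hi hvi hu hui hj hk
        revert i j k
        decide
      have hbot : X ⊓ coordHyp F 4 l = ⊥ := by
        refine eq_bot_of_forall_le_coordHyp fun m => ?_
        rcases hl m with rfl | rfl | rfl | rfl
        · exact inf_le_left.trans hi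
        · exact inf_le_left.trans ((hXY t).trans hj)
        · exact inf_le_left.trans ((hXY s).trans hk)
        · exact inf_le_right
      by_cases hXl : X ≤ coordHyp F 4 l
      · rw [inf_eq_left.mpr hXl] at hbot
        rw [hbot, finrank_bot] at hX
        omega
      · have := finrank_inf_of_not_le (finrank_coordHyp l) hXl
        rw [hbot, finrank_bot] at this
        omega
  obtain ⟨T, hT⟩ := Cardinal.exists_finset_le_card F 6 (by exact_mod_cast hF)
  have hbad : (T.filter fun t => IsDeg F 4 (Y t)).card ≤ 1 :=
    Finset.card_le_one.mpr fun t ht s hs =>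
      hdeg t s (Finset.mem_filter.mp ht).2 (Finset.mem_filter.mp hs).2
  have hsum := T.card_filter_add_card_filter_not fun t => IsDeg F 4 (Y t)
  refine ⟨(T.filter fun t => ¬ IsDeg F 4 (Y t)).image fun t => Tc F 4 2 (Y t), ?_, ?_⟩
  · rw [Finset.card_image_of_injOn]
    · omega
    · intro t ht s _ hts
      by_contra hne
      have hXeq : X = Y t ⊓ Y s := Submodule.eq_of_le_of_finrank_eq (le_inf (hXY t) (hXY s))
        (by rw [hX, finrank_inf_of_ne (hY t) (hY s) (hinj.ne hne)])
      exact Tc_ne_Tc hF (Finset.mem_filter.mp ht).2 (hY t) (hXeq ▸ ⟨i, hi⟩) hts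
  · intro S hS
    obtain ⟨t, ht, rfl⟩ := Finset.mem_image.mp hS
    exact ⟨Y t, hY t, (Finset.mem_filter.mp ht).2, hXY t, rfl⟩

/-- The complete graph on five vertices has no proper edge colouring with four colours. -/
lemma exists_monochromatic_pair (r : Fin 4 → Fin 5 → Fin 5 → Prop)
    (hsymm : ∀ i a b, r i a b → r i b a) (h : ∀ a b, a ≠ b → ∃ i, r i a b) :
    ∃ i a b c, a ≠ b ∧ a ≠ c ∧ b ≠ c ∧ r i a b ∧ r i a c := by
  by_contra! hcon
  have key (a : Fin 5) : ∃ b, a ≠ b ∧ r 0 a b := by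
    choose g hg using fun b : {b : Fin 5 // a ≠ b} => h a b b.2
    have hginj : Function.Injective g := by
      intro x y hxy
      by_contra hne
      exact hcon (g x) a x y x.2 y.2 (fun h => hne (Subtype.ext h)) (hg x) (hxy ▸ hg y)
    have hcard : Fintype.card {b : Fin 5 // a ≠ b} = Fintype.card (Fin 4) := by
      simp [Fintype.card_subtype_compl]
    obtain ⟨b, hb⟩ := ((Fintype.bijective_iff_injective_and_card g).mpr ⟨hginj, hcard⟩).2 0
    exact ⟨b, b.2, hb ▸ hg b⟩
  choose m hm hr using key
  have hinv : Function.Involutive m := by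
    intro a
    by_contra hne
    exact hcon 0 (m a) a (m (m a)) (hm a).symm (hm (m a)) (Ne.symm hne)
      (hsymm _ _ _ (hr a)) (hr (m a))
  have hdvd := Equiv.Perm.two_dvd_card_support (σ := hinv.toPerm)
    (by ext a; simp [sq, hinv a])
  have hsupp : hinv.toPerm.support = Finset.univ := by
    ext a
    simpa using (hm a).symm
  rw [hsupp] at hdvd
  revert hdvd
  decide

lemma exists_inf_coordHyp_eq {Y Z : Submodule F (Fin 4 → F)} (hY : finrank F Y = 3)
    (hZ : finrank F Z = 3) (hYn : IsNondeg F 4 Y) (hZn : IsNondeg F 4 Z) (hne : Y ≠ Z)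
    (h : Tc F 4 2 Y ∩ Tc F 4 2 Z = ∅) : ∃ i, Y ⊓ coordHyp F 4 i = Z ⊓ coordHyp F 4 i := by
  have h2 := finrank_inf_of_ne hY hZ hne
  obtain ⟨i, hi⟩ : IsDeg F 4 (Y ⊓ Z) := by
    by_contra hn
    exact Set.eq_empty_iff_forall_notMem.mp h (Y ⊓ Z)
      ⟨⟨h2, inf_le_left, hn⟩, ⟨h2, inf_le_right, hn⟩⟩
  have h3 : Y ⊓ Z = Y ⊓ coordHyp F 4 i := Submodule.eq_of_le_of_finrank_eq
    (le_inf inf_le_left hi) (by rw [h2, finrank_inf_coordHyp hY hYn])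
  have h4 : Y ⊓ Z = Z ⊓ coordHyp F 4 i := Submodule.eq_of_le_of_finrank_eq
    (le_inf inf_le_right hi) (by rw [h2, finrank_inf_coordHyp hZ hZn])
  exact ⟨i, h3.symm.trans h4⟩

lemma inf_coordHyp_le_of_inf_eq {A B D : Submodule F (Fin 4 → F)} {i j : Fin 4}
    (hA : finrank F A = 3) (hB : finrank F B = 3) (hAn : IsNondeg F 4 A) (hAB : A ≠ B)
    (hi : A ⊓ coordHyp F 4 i = B ⊓ coordHyp F 4 i)
    (hDA : D ⊓ coordHyp F 4 j = A ⊓ coordHyp F 4 j)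
    (hDB : D ⊓ coordHyp F 4 j = B ⊓ coordHyp F 4 j) : A ⊓ coordHyp F 4 i ≤ D := by
  have h2 := finrank_inf_of_ne hA hB hAB
  have h3 : A ⊓ coordHyp F 4 i = A ⊓ B := Submodule.eq_of_le_of_finrank_eq
    (le_inf inf_le_left (hi ▸ inf_le_left)) (by rw [h2, finrank_inf_coordHyp hA hAn])
  have h4 : A ⊓ coordHyp F 4 j = A ⊓ B := Submodule.eq_of_le_of_finrank_eq
    (le_inf inf_le_left ((hDA.symm.trans hDB) ▸ inf_le_left))
    (by rw [h2, finrank_inf_coordHyp hA hAn])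
  rw [h3, ← h4, ← hDA]
  exact inf_le_left

/-- Three hyperplanes with the same trace on a coordinate hyperplane: every hyperplane that has a
common coordinate trace with each of them contains that trace. -/
lemma inf_coordHyp_le_of_three {A B C D : Submodule F (Fin 4 → F)} {i : Fin 4}
    (hA : finrank F A = 3) (hB : finrank F B = 3) (hC : finrank F C = 3) (hD : finrank F D = 3)
    (hAn : IsNondeg F 4 A) (hBn : IsNondeg F 4 B) (hDn : IsNondeg F 4 D)
    (hAB : A ≠ B) (hAC : A ≠ C) (hBC : B ≠ C)
    (hiB : A ⊓ coordHyp F 4 i = B ⊓ coordHyp F 4 i)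
    (hiC : A ⊓ coordHyp F 4 i = C ⊓ coordHyp F 4 i)
    (hDA : ∃ j, D ⊓ coordHyp F 4 j = A ⊓ coordHyp F 4 j)
    (hDB : ∃ j, D ⊓ coordHyp F 4 j = B ⊓ coordHyp F 4 j)
    (hDC : ∃ j, D ⊓ coordHyp F 4 j = C ⊓ coordHyp F 4 j) : A ⊓ coordHyp F 4 i ≤ D := by
  by_contra hX
  obtain ⟨j, hj⟩ := hDA
  obtain ⟨k, hk⟩ := hDB
  obtain ⟨l, hl⟩ := hDC
  have hji : j ≠ i := by rintro rfl; exact hX (hj ▸ inf_le_left)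
  have hki : k ≠ i := by rintro rfl; exact hX (hiB ▸ hk ▸ inf_le_left)
  have hli : l ≠ i := by rintro rfl; exact hX (hiC ▸ hl ▸ inf_le_left)
  have hjk : j ≠ k := by
    rintro rfl; exact hX (inf_coordHyp_le_of_inf_eq hA hB hAn hAB hiB hj hk)
  have hjl : j ≠ l := by
    rintro rfl; exact hX (inf_coordHyp_le_of_inf_eq hA hC hAn hAC hiC hj hl)
  have hkl : k ≠ l := by
    rintro rfl
    exact hX (hiB ▸ inf_coordHyp_le_of_inf_eq hB hC hBn hBC (hiB.symm.trans hiC) hk hl)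
  have hall : ∀ m, m = i ∨ m = j ∨ m = k ∨ m = l := by
    clear hj hk hl hX hiB hiC
    revert i j k l
    decide
  have hle (Z : Submodule F (Fin 4 → F)) (m : Fin 4) (hZ3 : finrank F Z = 3)
      (hZ : A ⊓ coordHyp F 4 i = Z ⊓ coordHyp F 4 i)
      (hm : D ⊓ coordHyp F 4 m = Z ⊓ coordHyp F 4 m) :
      A ⊓ coordHyp F 4 i ⊓ D ≤ coordHyp F 4 m := by
    have hXZ : A ⊓ coordHyp F 4 i ≤ Z := hZ ▸ inf_le_left
    have hDZ : D ⊓ coordHyp F 4 m = D ⊓ Z := Submodule.eq_of_le_of_finrank_eq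
      (le_inf inf_le_left (hm ▸ inf_le_left)) (by
        rw [finrank_inf_coordHyp hD hDn, finrank_inf_of_ne hD hZ3 fun h => hX (h ▸ hXZ)])
    have h : A ⊓ coordHyp F 4 i ⊓ D ≤ D ⊓ Z :=
      le_inf inf_le_right (inf_le_left.trans hXZ)
    exact (hDZ ▸ h).trans inf_le_right
  have hbot : A ⊓ coordHyp F 4 i ⊓ D = ⊥ := by
    refine eq_bot_of_forall_le_coordHyp fun m => ?_
    rcases hall m with rfl | rfl | rfl | rfl
    · exact inf_le_left.trans inf_le_right
    · exact hle A _ hA rfl hj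
    · exact hle B _ hB hiB hk
    · exact hle C _ hC hiC hl
  have h1 := finrank_inf_of_not_le hD hX
  rw [hbot, finrank_bot, finrank_inf_coordHyp hA hAn] at h1
  omega

end TopsOfCoordinateSpace

/-- for `|F| ≥ 6`, `n = 4`, `k = 2`, a maximal clique of `Δ'_t` is linear
iff it contains at least five elements. -/
theorem stmt16 (F : Type*) [Field F] (hF : (6 : Cardinal) ≤ Cardinal.mk F)
    (𝒳 : Set (Set (Submodule F (Fin 4 → F))))
    (h𝒳 : IsMaxCliqueDt' F 4 2 𝒳) :
    (∃ X : Submodule F (Fin 4 → F),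
        finrank F ↥X = 2 ∧ IsDeg F 4 X ∧ 𝒳 = TopsThrough F 4 2 X) ↔
      ∃ s : Finset (Set (Submodule F (Fin 4 → F))), 5 ≤ s.card ∧ ↑s ⊆ 𝒳 := by
  constructor
  · rintro ⟨X, hX, hXd, rfl⟩
    exact exists_five_topsThrough hF hX hXd
  · rintro ⟨s, hs, hsub⟩
    obtain ⟨⟨htop, hadj⟩, hmax⟩ := h𝒳
    have hrep : ∀ T ∈ 𝒳, ∃ Y : Submodule F (Fin 4 → F),
        finrank F Y = 3 ∧ IsNondeg F 4 Y ∧ T = Tc F 4 2 Y := by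
      intro T hT
      obtain ⟨⟨Y, hY, rfl⟩, hm⟩ := htop T hT
      exact ⟨Y, hY, isNondeg_of_isTopD_Tc hF ⟨⟨Y, hY, rfl⟩, hm⟩, rfl⟩
    choose! Y hY hYn hYT using hrep
    have hcolor {T T' : Set (Submodule F (Fin 4 → F))} (hT : T ∈ 𝒳) (hT' : T' ∈ 𝒳) :
        ∃ i, Y T ⊓ coordHyp F 4 i = Y T' ⊓ coordHyp F 4 i := by
      by_cases heq : T = T'
      · exact ⟨0, by rw [heq]⟩
      · refine exists_inf_coordHyp_eq (hY T hT) (hY T' hT') (hYn T hT) (hYn T' hT') (fun h => ?_) ?_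
        · exact heq ((hYT T hT).trans (h ▸ (hYT T' hT').symm))
        · rw [← hYT T hT, ← hYT T' hT']
          exact (hadj T hT T' hT' heq).2
    obtain ⟨f⟩ : Nonempty (Fin 5 ↪ s) :=
      Function.Embedding.nonempty_of_card_le (by simpa using hs)
    have hf (a : Fin 5) : (f a).1 ∈ 𝒳 := hsub (f a).2
    have hYinj {a b : Fin 5} (hab : a ≠ b) : Y (f a) ≠ Y (f b) := fun h =>
      hab (f.injective (Subtype.ext (by rw [hYT _ (hf a), hYT _ (hf b), h])))
    obtain ⟨i, a, b, c, hab, hac, hbc, hib, hic⟩ := exists_monochromatic_pair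
      (fun i a b => Y (f a) ⊓ coordHyp F 4 i = Y (f b) ⊓ coordHyp F 4 i) (fun _ _ _ h => h.symm)
      fun a b _ => hcolor (hf a) (hf b)
    have hX := finrank_inf_coordHyp (hY _ (hf a)) (hYn _ (hf a)) i
    have hXd : IsDeg F 4 (Y (f a) ⊓ coordHyp F 4 i) := ⟨i, inf_le_right⟩
    refine ⟨_, hX, hXd, (hmax _ (isCliqueDt'_topsThrough hF hX hXd) fun T hT => ?_).symm⟩
    exact ⟨Y T, hY T hT, hYn T hT, inf_coordHyp_le_of_three (hY _ (hf a)) (hY _ (hf b))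
      (hY _ (hf c)) (hY T hT) (hYn _ (hf a)) (hYn _ (hf b)) (hYn T hT) (hYinj hab) (hYinj hac)
      (hYinj hbc) hib hic (hcolor hT (hf a)) (hcolor hT (hf b)) (hcolor hT (hf c)), hYT T hT⟩
end

section
/- Let F = F_q be the finite field with q ≥ 3 elements, n = 4 and k = 2. Then: (1) a maximal clique of Δ'_t is a linear maximal clique of type 1 or 2 if and only if its intersection with every other maximal clique of Δ'_t contains at most one element; (2) a linear maximal clique of type 1 or 2 is of type 2 if and only if it contains exactly q−1 elements; (3) a maximal clique of Δ'_t which is not a linear maximal clique of type 1 or 2 is a linear maximal clique of type 3 if and only if it has non-empty intersection with some linear maximal clique of type 2. -/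
open Module

section Linear

variable (F : Type*) [Field F]

/-- A linear maximal clique of `Δ'_t` of type 1: `𝔗_X` where the degenerate `2`-dimensional
subspace `X` contains no coordinate axis. -/
def IsLinMC1 (𝒳 : Set (Set (Submodule F (Fin 4 → F)))) : Prop :=
  IsMaxCliqueDt' F 4 2 𝒳 ∧
    ∃ X : Submodule F (Fin 4 → F), finrank F ↥X = 2 ∧ IsDeg F 4 X ∧
      𝒳 = TopsThrough F 4 2 X ∧
      ∀ j : Fin 4, ¬ (Submodule.span F {Pi.single j (1 : F)} ≤ X)

/-- A linear maximal clique of `Δ'_t` of type 2: `𝔗_X` where `X ⊆ C_i ∩ C_j` for some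
distinct `i, j`. -/
def IsLinMC2 (𝒳 : Set (Set (Submodule F (Fin 4 → F)))) : Prop :=
  IsMaxCliqueDt' F 4 2 𝒳 ∧
    ∃ X : Submodule F (Fin 4 → F), finrank F ↥X = 2 ∧ IsDeg F 4 X ∧
      𝒳 = TopsThrough F 4 2 X ∧
      ∃ i j : Fin 4, i ≠ j ∧ X ≤ coordHyp F 4 i ⊓ coordHyp F 4 j

/-- A linear maximal clique of `Δ'_t` of type 3: `𝔗_X` where `X` contains a coordinate axis
but is not of type 2. -/
def IsLinMC3 (𝒳 : Set (Set (Submodule F (Fin 4 → F)))) : Prop :=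
  IsMaxCliqueDt' F 4 2 𝒳 ∧
    ∃ X : Submodule F (Fin 4 → F), finrank F ↥X = 2 ∧ IsDeg F 4 X ∧
      𝒳 = TopsThrough F 4 2 X ∧
      (∃ j : Fin 4, Submodule.span F {Pi.single j (1 : F)} ≤ X) ∧
      ¬ ∃ i j : Fin 4, i ≠ j ∧ X ≤ coordHyp F 4 i ⊓ coordHyp F 4 j

end Linear

section Hyperplanes

variable {F : Type*} [Field F]

/-- The hyperplane of `F^4` orthogonal to `a`. -/
def hyp (a : Fin 4 → F) : Submodule F (Fin 4 → F) :=
  LinearMap.ker (dotProductEquiv F (Fin 4) a)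

/-- The vector `a` has at least two non-zero coordinates. -/
def TwoSupp (a : Fin 4 → F) : Prop :=
  ∃ m n, m ≠ n ∧ a m ≠ 0 ∧ a n ≠ 0

theorem mem_hyp {a x : Fin 4 → F} : x ∈ hyp a ↔ a ⬝ᵥ x = 0 := by
  simp [hyp]

theorem coordHyp_eq_hyp (i : Fin 4) : coordHyp F 4 i = hyp (Pi.single i 1) := by
  ext x
  simp [coordHyp, mem_hyp]

theorem mem_coordHyp {i : Fin 4} {x : Fin 4 → F} : x ∈ coordHyp F 4 i ↔ x i = 0 := by
  simp [coordHyp]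

theorem finrank_hyp {a : Fin 4 → F} (ha : a ≠ 0) : finrank F (hyp a) = 3 := by
  have h := Module.Dual.finrank_ker_add_one_of_ne_zero
    (f := dotProductEquiv F (Fin 4) a) (by simpa using ha)
  rw [Module.finrank_fin_fun] at h
  unfold hyp
  omega

theorem TwoSupp.ne_zero {a : Fin 4 → F} (ha : TwoSupp a) : a ≠ 0 := by
  rintro rfl
  obtain ⟨m, n, -, h, -⟩ := ha
  simp at h

theorem TwoSupp.exists_ne {a : Fin 4 → F} (ha : TwoSupp a) (i : Fin 4) :
    ∃ m, m ≠ i ∧ a m ≠ 0 := by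
  obtain ⟨m, n, hmn, hm, hn⟩ := ha
  by_cases h : m = i
  · exact ⟨n, fun h' => hmn (h.trans h'.symm), hn⟩
  · exact ⟨m, h, hm⟩

theorem twoSupp_smul {a : Fin 4 → F} {c : F} (hc : c ≠ 0) : TwoSupp (c • a) ↔ TwoSupp a := by
  simp [TwoSupp, hc]

theorem hyp_smul {a : Fin 4 → F} {c : F} (hc : c ≠ 0) : hyp (c • a) = hyp a := by
  ext x
  simp [mem_hyp, hc]

theorem TwoSupp.isNondeg_hyp {a : Fin 4 → F} (ha : TwoSupp a) : IsNondeg F 4 (hyp a) := by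
  rintro ⟨i, hi⟩
  obtain ⟨m, hm, ham⟩ := ha.exists_ne i
  have h : (Pi.single i 1 - Pi.single m (a i / a m) : Fin 4 → F) ∈ hyp a := by
    simp [mem_hyp, dotProduct_sub, mul_div_cancel₀ _ ham]
  have := mem_coordHyp.1 (hi h)
  simp [hm.symm] at this

theorem twoSupp_of_isNondeg_hyp {a : Fin 4 → F} (ha : a ≠ 0) (h : IsNondeg F 4 (hyp a)) :
    TwoSupp a := by
  by_contra hn
  obtain ⟨i, hi⟩ := Function.ne_iff.1 ha
  refine h ⟨i, fun x hx => mem_coordHyp.2 ?_⟩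
  have hz : a = Pi.single i (a i) := by
    ext m
    by_cases hm : m = i
    · subst hm; simp
    · by_contra h0
      exact hn ⟨m, i, hm, by simpa [Pi.single_apply, hm] using h0, hi⟩
  rw [mem_hyp, hz, single_dotProduct] at hx
  exact (mul_eq_zero.1 hx).resolve_left hi

theorem exists_eq_hyp {Y : Submodule F (Fin 4 → F)} (hY : finrank F Y = 3) :
    ∃ a, a ≠ 0 ∧ Y = hyp a := by
  have hlt : Y < ⊤ := by
    rw [lt_top_iff_ne_top]
    rintro rfl
    simp at hY
  obtain ⟨f, hf, hYf⟩ := Submodule.exists_le_ker_of_lt_top Y hlt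
  obtain ⟨a, rfl⟩ := (dotProductEquiv F (Fin 4)).surjective f
  have ha : a ≠ 0 := by
    rintro rfl
    simp at hf
  exact ⟨a, ha, Submodule.eq_of_le_of_finrank_eq hYf (by rw [hY]; exact (finrank_hyp ha).symm)⟩

theorem finrank_inf_hyp {A : Submodule F (Fin 4 → F)} {b : Fin 4 → F} (h : ¬ A ≤ hyp b) :
    finrank F ↥(A ⊓ hyp b) + 1 = finrank F A := by
  have hb : b ≠ 0 := by
    rintro rfl
    exact h fun x _ => by simp [mem_hyp]
  have h1 := Submodule.finrank_sup_add_finrank_inf_eq A (hyp b)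
  have h2 : finrank F (hyp b) < finrank F ↥(A ⊔ hyp b) :=
    Submodule.finrank_lt_finrank_of_lt
      (lt_of_le_of_ne le_sup_right fun he => h (he ▸ le_sup_left))
  have h3 := Submodule.finrank_le (A ⊔ hyp b)
  rw [Module.finrank_fin_fun] at h3
  rw [finrank_hyp hb] at h1 h2
  omega

theorem exists_comb_of_inf_hyp_le {a b c : Fin 4 → F} (h : hyp a ⊓ hyp b ≤ hyp c) :
    ∃ s t : F, c = s • a + t • b := by
  have := mem_span_of_iInf_ker_le_ker (L := ![dotProductEquiv F (Fin 4) a,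
    dotProductEquiv F (Fin 4) b]) (K := dotProductEquiv F (Fin 4) c) (by
      intro x hx
      simp only [Submodule.mem_iInf, Fin.forall_fin_two] at hx
      exact h hx)
  simp only [Matrix.range_cons, Matrix.range_empty, Set.union_empty, Set.singleton_union] at this
  obtain ⟨s, t, hst⟩ := Submodule.mem_span_pair.1 this
  refine ⟨s, t, (dotProductEquiv F (Fin 4)).injective ?_⟩
  rw [← hst]
  simp

theorem exists_smul_of_hyp_le {a b : Fin 4 → F} (hb : b ≠ 0) (h : hyp a ≤ hyp b) :
    ∃ c : F, c ≠ 0 ∧ b = c • a := by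
  obtain ⟨s, t, hst⟩ := exists_comb_of_inf_hyp_le (a := a) (b := a) (inf_le_left.trans h)
  refine ⟨s + t, ?_, by rw [hst, add_smul]⟩
  intro h0
  rw [← add_smul, h0, zero_smul] at hst
  exact hb hst

end Hyperplanes

section Tops

variable {F : Type*} [Field F]

/-- The set of non-degenerate lines in the hyperplane orthogonal to `a`. -/
def topOf (a : Fin 4 → F) : Set (Submodule F (Fin 4 → F)) :=
  Tc F 4 2 (hyp a)

theorem exists_mem_ne_zero_of_finrank_pos {W : Submodule F (Fin 4 → F)} (h : 0 < finrank F W) :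
    ∃ v ∈ W, v ≠ 0 :=
  Submodule.exists_mem_ne_zero_of_ne_bot fun h0 => by
    rw [h0] at h
    simp at h

theorem topOf_smul {a : Fin 4 → F} {c : F} (hc : c ≠ 0) : topOf (c • a) = topOf a := by
  simp [topOf, hyp_smul hc]

theorem exists_mem_forall_ne_zero [Fintype F] (hq : 3 ≤ Fintype.card F)
    {W : Submodule F (Fin 4 → F)} (hW : IsNondeg F 4 W) (J : Finset (Fin 4)) (hJ : J.card ≤ 3) :
    ∃ w ∈ W, ∀ j ∈ J, w j ≠ 0 := by
  classical
  induction J using Finset.induction_on with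
  | empty => exact ⟨0, W.zero_mem, by simp⟩
  | insert k J hk ih =>
    rw [Finset.card_insert_of_notMem hk] at hJ
    obtain ⟨w, hw, hwJ⟩ := ih (by omega)
    by_cases hwk : w k = 0
    · obtain ⟨u, hu, huk⟩ : ∃ u ∈ W, u k ≠ 0 := by
        by_contra! hn
        exact hW ⟨k, fun x hx => mem_coordHyp.2 (hn x hx)⟩
      obtain ⟨t, ht⟩ : ∃ t, t ∉ J.image fun j => -u j / w j := by
        by_contra! hn
        have h1 := Finset.card_le_card (fun t _ => hn t : (Finset.univ : Finset F) ⊆ _)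
        have h2 := Finset.card_image_le (s := J) (f := fun j => -u j / w j)
        rw [Finset.card_univ] at h1
        omega
      refine ⟨t • w + u, W.add_mem (W.smul_mem t hw) hu, fun j hj => ?_⟩
      rcases Finset.mem_insert.1 hj with rfl | hj
      · simpa [hwk] using huk
      · intro h0
        refine ht (Finset.mem_image.2 ⟨j, hj, ?_⟩)
        rw [div_eq_iff (hwJ j hj)]
        simp only [Pi.add_apply, Pi.smul_apply, smul_eq_mul] at h0
        linear_combination -h0
    · refine ⟨w, hw, fun j hj => ?_⟩
      rcases Finset.mem_insert.1 hj with rfl | hj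
      exacts [hwk, hwJ j hj]

theorem exists_dotProduct_ne_zero_forall_ne_comb [Fintype F] (hq : 3 ≤ Fintype.card F)
    (a v : Fin 4 → F) (hv : v ≠ 0) :
    ∃ b : Fin 4 → F, b ⬝ᵥ v ≠ 0 ∧
      ∀ j : Fin 4, ∀ s t : F, b ≠ s • a + t • (Pi.single j 1 : Fin 4 → F) := by
  classical
  by_contra! hn
  let S : Finset (Fin 4 → F) := Finset.univ.filter (· ∈ hyp v)
  let R : Fin 4 → Finset (Fin 4 → F) := fun j =>
    Finset.univ.image fun p : F × F => p.1 • a + p.2 • (Pi.single j 1 : Fin 4 → F)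
  have hcov : (Finset.univ : Finset (Fin 4 → F)) ⊆ S ∪ Finset.univ.biUnion R := by
    intro b _
    by_cases hb : b ⬝ᵥ v = 0
    · refine Finset.mem_union_left _ (Finset.mem_filter.2 ⟨Finset.mem_univ _, ?_⟩)
      rwa [mem_hyp, dotProduct_comm]
    · obtain ⟨j, s, t, h⟩ := hn b hb
      refine Finset.mem_union_right _ (Finset.mem_biUnion.2 ⟨j, Finset.mem_univ _, ?_⟩)
      exact Finset.mem_image.2 ⟨(s, t), Finset.mem_univ _, h.symm⟩
  have hS : S.card = Fintype.card F ^ 3 := by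
    rw [← finrank_hyp hv, ← Module.card_eq_pow_finrank (K := F) (V := hyp v),
      Fintype.card_subtype]
  have hR : ∀ j, (R j).card ≤ Fintype.card F ^ 2 := by
    intro j
    refine Finset.card_image_le.trans ?_
    simp [sq]
  have h1 := (Finset.card_le_card hcov).trans (Finset.card_union_le _ _)
  have h2 : (Finset.univ.biUnion R).card ≤ 4 * Fintype.card F ^ 2 := by
    refine Finset.card_biUnion_le.trans ((Finset.sum_le_sum fun j _ => hR j).trans ?_)
    simp
  rw [Finset.card_univ, Fintype.card_fun, Fintype.card_fin, hS] at h1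
  generalize Fintype.card F = q at *
  have h3 : q ^ 4 ≤ q ^ 3 + 4 * q ^ 2 := by omega
  have h4 : q ^ 2 * (q + 4) < q ^ 2 * q ^ 2 :=
    Nat.mul_lt_mul_of_pos_left (by nlinarith) (by positivity)
  nlinarith

theorem TwoSupp.exists_mem_topOf [Fintype F] (hq : 3 ≤ Fintype.card F) {a v : Fin 4 → F}
    (ha : TwoSupp a) (hv : v ≠ 0) (hva : v ∈ hyp a) : ∃ B ∈ topOf a, v ∉ B := by
  obtain ⟨b, hb, hbs⟩ := exists_dotProduct_ne_zero_forall_ne_comb hq a v hv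
  have hvb : v ∉ hyp b := fun h => hb (mem_hyp.1 h)
  have hab : ¬ hyp a ≤ hyp b := fun h => hvb (h hva)
  refine ⟨hyp a ⊓ hyp b, ⟨?_, inf_le_left, ?_⟩, fun h => hvb h.2⟩
  · have := finrank_inf_hyp hab
    rw [finrank_hyp ha.ne_zero] at this
    omega
  · rintro ⟨j, hj⟩
    rw [coordHyp_eq_hyp] at hj
    obtain ⟨s, t, hst⟩ := exists_comb_of_inf_hyp_le hj
    have ht : t ≠ 0 := by
      rintro rfl
      obtain ⟨m, hm, ham⟩ := ha.exists_ne j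
      have h1 := congrFun hst m
      have h2 := congrFun hst j
      simp [hm, ham] at h1
      simp [h1] at h2
    refine hbs j (-s / t) (1 / t) ?_
    rw [hst]
    ext m
    simp
    field_simp
    ring

theorem topOf_eq_topOf_iff [Fintype F] (hq : 3 ≤ Fintype.card F) {a b : Fin 4 → F}
    (ha : TwoSupp a) (hb : TwoSupp b) : topOf a = topOf b ↔ ∃ c : F, c ≠ 0 ∧ b = c • a := by
  constructor
  · intro h
    refine exists_smul_of_hyp_le hb.ne_zero ?_
    by_contra hab
    have h1 := finrank_inf_hyp hab
    rw [finrank_hyp ha.ne_zero] at h1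
    obtain ⟨v, hv, hv0⟩ := exists_mem_ne_zero_of_finrank_pos (W := hyp a ⊓ hyp b) (by omega)
    obtain ⟨B, hB, hvB⟩ := ha.exists_mem_topOf hq hv0 hv.1
    have hB' := h ▸ hB
    have : B = hyp a ⊓ hyp b := Submodule.eq_of_le_of_finrank_eq
      (le_inf hB.2.1 hB'.2.1) (by rw [hB.1]; omega)
    exact hvB (this ▸ hv)
  · rintro ⟨c, hc, rfl⟩
    exact (topOf_smul hc).symm

theorem adjK_of_le_hyp {a : Fin 4 → F} (ha : a ≠ 0) {A B : Submodule F (Fin 4 → F)}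
    (hA : finrank F A = 2) (hB : finrank F B = 2) (hAa : A ≤ hyp a) (hBa : B ≤ hyp a)
    (hAB : A ≠ B) : AdjK F 4 2 A B := by
  refine ⟨hAB, ?_⟩
  have h1 := Submodule.finrank_sup_add_finrank_inf_eq A B
  have h2 := Submodule.finrank_mono (sup_le hAa hBa)
  rw [finrank_hyp ha] at h2
  have h3 : finrank F ↥(A ⊓ B) < finrank F A :=
    Submodule.finrank_lt_finrank_of_lt (lt_of_le_of_ne inf_le_left fun h =>
      hAB (Submodule.eq_of_le_of_finrank_eq (inf_eq_left.1 h) (hA.trans hB.symm)))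
  omega

theorem TwoSupp.isTopD_topOf [Fintype F] (hq : 3 ≤ Fintype.card F) {a : Fin 4 → F}
    (ha : TwoSupp a) : IsTopD F 4 2 (topOf a) := by
  refine ⟨⟨hyp a, finrank_hyp ha.ne_zero, rfl⟩, ⟨fun A hA => ⟨hA.1, hA.2.2⟩,
    fun A hA B hB hAB => adjK_of_le_hyp ha.ne_zero hA.1 hB.1 hA.2.1 hB.2.1 hAB⟩, ?_⟩
  refine fun D hD hle => (Set.Subset.antisymm hle fun A hA => ?_).symm
  refine ⟨(hD.1 A hA).1, ?_, (hD.1 A hA).2⟩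
  by_contra hAa
  have h1 := finrank_inf_hyp hAa
  rw [(hD.1 A hA).1] at h1
  obtain ⟨v, hv, hv0⟩ := exists_mem_ne_zero_of_finrank_pos (W := A ⊓ hyp a) (by omega)
  obtain ⟨B, hB, hvB⟩ := ha.exists_mem_topOf hq hv0 hv.2
  have hAB : A ≠ B := by
    rintro rfl
    exact hAa hB.2.1
  have h2 := (hD.2 A hA B (hle hB) hAB).2
  have h3 : A ⊓ B = A ⊓ hyp a := Submodule.eq_of_le_of_finrank_eq
    (inf_le_inf_left A hB.2.1) (by omega)
  exact hvB ((h3.symm ▸ hv : v ∈ A ⊓ B).2)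

theorem exists_twoSupp_of_isTopD [Fintype F] (hq : 3 ≤ Fintype.card F)
    {T : Set (Submodule F (Fin 4 → F))} (hT : IsTopD F 4 2 T) :
    ∃ a, TwoSupp a ∧ T = topOf a := by
  obtain ⟨⟨Y, hY, rfl⟩, hmax⟩ := hT
  obtain ⟨a, ha0, rfl⟩ := exists_eq_hyp hY
  refine ⟨a, twoSupp_of_isNondeg_hyp ha0 fun ⟨i, hi⟩ => ?_, rfl⟩
  have hempty : Tc F 4 2 (hyp a) = ∅ :=
    Set.eq_empty_of_forall_notMem fun A hA => hA.2.2 ⟨i, hA.2.1.trans hi⟩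
  have hs : TwoSupp (Pi.single 0 1 + Pi.single 1 1 : Fin 4 → F) := ⟨0, 1, by simp, by simp, by simp⟩
  obtain ⟨B, hB, -⟩ := hs.exists_mem_topOf hq (v := Pi.single 2 1) (by simp) (by simp [mem_hyp])
  have := hmax.2 {B} ⟨by rintro _ rfl; exact ⟨hB.1, hB.2.2⟩,
    by rintro _ rfl _ rfl h; exact absurd rfl h⟩ (by simp [hempty])
  rw [hempty] at this
  exact Set.singleton_ne_empty B this

theorem exists_adjK_mem_topOf [Fintype F] (hq : 3 ≤ Fintype.card F) {a b : Fin 4 → F}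
    (hb : TwoSupp b) {i : Fin 4} (hi : hyp a ⊓ hyp b ≤ coordHyp F 4 i)
    {A : Submodule F (Fin 4 → F)} (hA : A ∈ topOf a) : ∃ B ∈ topOf b, AdjK F 4 2 A B := by
  classical
  have hAb : ¬ A ≤ hyp b := fun h => hA.2.2 ⟨i, (le_inf hA.2.1 h).trans hi⟩
  have h1 := finrank_inf_hyp hAb
  rw [hA.1] at h1
  obtain ⟨v, hv, hv0⟩ := exists_mem_ne_zero_of_finrank_pos (W := A ⊓ hyp b) (by omega)
  have hvi : v i = 0 := mem_coordHyp.1 (hi ⟨hA.2.1 hv.1, hv.2⟩)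
  obtain ⟨k, hk⟩ := Function.ne_iff.1 hv0
  obtain ⟨w, hw, hwJ⟩ := exists_mem_forall_ne_zero hq hb.isNondeg_hyp (Finset.univ.erase k)
    (by simp)
  have hwz : ∀ j, v j = 0 → w j ≠ 0 := fun j hj => hwJ j
    (Finset.mem_erase.2 ⟨by rintro rfl; exact hk hj, Finset.mem_univ _⟩)
  have hli : LinearIndependent F ![v, w] := by
    rw [LinearIndependent.pair_iff]
    intro s t hst
    have ht : t = 0 := by
      have := congrFun hst i
      simpa [hvi, hwz i hvi] using this
    subst ht
    simpa [hv0] using hst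
  have hB : finrank F (Submodule.span F {v, w}) = 2 := by
    have := finrank_span_eq_card hli
    rwa [Matrix.range_cons_cons_empty, Fintype.card_fin] at this
  have hBle : Submodule.span F {v, w} ≤ hyp b := Submodule.span_le.2 (by
    rintro x (rfl | rfl)
    exacts [hv.2, hw])
  have hvB : v ∈ Submodule.span F {v, w} := Submodule.subset_span (by simp)
  have hwB : w ∈ Submodule.span F {v, w} := Submodule.subset_span (by simp)
  refine ⟨_, ⟨hB, hBle, ?_⟩, ?_, ?_⟩
  · rintro ⟨j, hj⟩
    exact hwz j (mem_coordHyp.1 (hj hvB)) (mem_coordHyp.1 (hj hwB))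
  · rintro rfl
    exact hAb hBle
  · have h2 := Submodule.finrank_mono (inf_le_inf_left A hBle)
    have h3 : 1 ≤ finrank F ↥(A ⊓ Submodule.span F {v, w}) :=
      Submodule.one_le_finrank_iff.2 fun h =>
        hv0 ((Submodule.mem_bot F).1 (h ▸ (⟨hv.1, hvB⟩ : v ∈ A ⊓ Submodule.span F {v, w})))
    omega

/-- The vectors `a` and `b` agree outside the coordinate `i`, up to a non-zero scalar. -/
def NearAt (i : Fin 4) (a b : Fin 4 → F) : Prop :=
  ∃ c : F, c ≠ 0 ∧ ∀ m, m ≠ i → b m = c * a m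

theorem NearAt.exists_eq_add {i : Fin 4} {a b : Fin 4 → F} (h : NearAt i a b) :
    ∃ c d : F, c ≠ 0 ∧ b = c • a + d • Pi.single i 1 := by
  obtain ⟨c, hc, h⟩ := h
  refine ⟨c, b i - c * a i, hc, funext fun m => ?_⟩
  by_cases hm : m = i
  · subst hm
    simp
  · simp [hm, h m hm]

/-- Two tops are adjacent in `Δ'_t` exactly when representing vectors differ, up to scaling,
in a single coordinate. -/
theorem adjMC'_topOf_iff [Fintype F] (hq : 3 ≤ Fintype.card F) {a b : Fin 4 → F}
    (ha : TwoSupp a) (hb : TwoSupp b) :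
    AdjMC' F 4 2 (topOf a) (topOf b) ↔
      topOf a ≠ topOf b ∧ ∃ i, NearAt i a b := by
  constructor
  · rintro ⟨⟨hne, -⟩, hdisj⟩
    refine ⟨hne, ?_⟩
    have hab : ¬ hyp a ≤ hyp b := fun h =>
      hne ((topOf_eq_topOf_iff hq ha hb).2 (exists_smul_of_hyp_le hb.ne_zero h))
    have h1 := finrank_inf_hyp hab
    rw [finrank_hyp ha.ne_zero] at h1
    obtain ⟨i, hi⟩ : IsDeg F 4 (hyp a ⊓ hyp b) := by
      by_contra hn
      exact Set.eq_empty_iff_forall_notMem.1 hdisj (hyp a ⊓ hyp b)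
        ⟨⟨by omega, inf_le_left, hn⟩, ⟨by omega, inf_le_right, hn⟩⟩
    rw [coordHyp_eq_hyp] at hi
    obtain ⟨s, t, hst⟩ := exists_comb_of_inf_hyp_le hi
    have ht : t ≠ 0 := by
      rintro rfl
      obtain ⟨m, hm, ham⟩ := ha.exists_ne i
      have h1 := congrFun hst m
      have h2 := congrFun hst i
      simp [hm, ham] at h1
      simp [h1] at h2
    have hs : s ≠ 0 := by
      rintro rfl
      obtain ⟨m, hm, hbm⟩ := hb.exists_ne i
      have h1 := congrFun hst m
      simp [hm, hbm, ht] at h1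
    refine ⟨i, -s / t, by simp [hs, ht], fun m hm => ?_⟩
    have hm' := congrFun hst m
    simp only [Pi.single_eq_of_ne hm, Pi.add_apply, Pi.smul_apply, smul_eq_mul] at hm'
    field_simp
    linear_combination -hm'
  · rintro ⟨hne, i, hab⟩
    obtain ⟨c, d, hc, hb'⟩ := hab.exists_eq_add
    have hd : d ≠ 0 := by
      rintro rfl
      exact hne ((topOf_eq_topOf_iff hq ha hb).2 ⟨c, hc, by simpa using hb'⟩)
    have hi : hyp a ⊓ hyp b ≤ coordHyp F 4 i := by
      rintro x ⟨hxa, hxb⟩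
      have hxa := mem_hyp.1 hxa
      have hxb := mem_hyp.1 hxb
      rw [hb', add_dotProduct, smul_dotProduct, hxa, smul_dotProduct, single_dotProduct] at hxb
      rw [mem_coordHyp]
      simpa [hd] using hxb
    refine ⟨⟨hne, fun A hA => exists_adjK_mem_topOf hq hb hi hA, fun A hA =>
      exists_adjK_mem_topOf hq ha (inf_comm (hyp a) (hyp b) ▸ hi) hA⟩, ?_⟩
    exact Set.eq_empty_of_forall_notMem fun A hA =>
      hA.1.2.2 ⟨i, (le_inf hA.1.2.1 hA.2.2.1).trans hi⟩

end Tops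

section AxisLines

variable {F : Type*} [Field F]

theorem NearAt.refl (i : Fin 4) (a : Fin 4 → F) : NearAt i a a :=
  ⟨1, one_ne_zero, by simp⟩

theorem NearAt.symm {i : Fin 4} {a b : Fin 4 → F} (h : NearAt i a b) : NearAt i b a := by
  obtain ⟨c, hc, h⟩ := h
  exact ⟨c⁻¹, inv_ne_zero hc, fun m hm => by rw [h m hm, inv_mul_cancel_left₀ hc]⟩

theorem NearAt.trans {i : Fin 4} {a b c : Fin 4 → F} (h : NearAt i a b) (h' : NearAt i b c) :
    NearAt i a c := by
  obtain ⟨s, hs, h⟩ := h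
  obtain ⟨t, ht, h'⟩ := h'
  exact ⟨t * s, mul_ne_zero ht hs, fun m hm => by rw [h' m hm, h m hm, mul_assoc]⟩

theorem nearAt_smul (i : Fin 4) (a : Fin 4 → F) {c : F} (hc : c ≠ 0) : NearAt i a (c • a) :=
  ⟨c, hc, by simp⟩

theorem nearAt_update (i : Fin 4) (a : Fin 4 → F) (x : F) :
    NearAt i a (Function.update a i x) :=
  ⟨1, one_ne_zero, fun m hm => by simp [hm]⟩

theorem exists_forall_eq_of_distinct : ∀ i j k : Fin 4, i ≠ j → i ≠ k → j ≠ k →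
    ∃ l, l ≠ i ∧ l ≠ j ∧ l ≠ k ∧ ∀ m, m = i ∨ m = j ∨ m = k ∨ m = l := by
  decide

/-- Three pairwise near vectors are either all near at the same coordinate or have exactly one
zero coordinate. -/
theorem NearAt.triangle {i j k : Fin 4} {a b c : Fin 4 → F} (ha : TwoSupp a) (hc : TwoSupp c)
    (hab : NearAt i a b) (hac : NearAt j a c) (hbc : NearAt k b c)
    (hne : ∀ s : F, s ≠ 0 → b ≠ s • a) :
    NearAt i a c ∨ ∃ l, l ≠ i ∧ ∀ m, a m = 0 ↔ m = l := by
  by_cases hji : j = i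
  · exact .inl (hji ▸ hac)
  by_cases hki : k = i
  · exact .inl (hab.trans (hki ▸ hbc))
  have hab' := hab
  obtain ⟨s, hs, hab⟩ := hab
  have hac' := hac
  obtain ⟨α, hα, hac⟩ := hac
  have hbc' := hbc
  obtain ⟨β, hβ, hbc⟩ := hbc
  have hbi : b i ≠ s * a i := fun h => hne s hs <| funext fun m => by
    by_cases hm : m = i
    · simpa [hm] using h
    · simpa using hab m hm
  have hi : α * a i = β * b i := by rw [← hac i (Ne.symm hji), hbc i (Ne.symm hki)]
  have hαβ : α ≠ β * s := by
    rintro rfl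
    exact hbi (mul_left_cancel₀ hβ (by rw [← hi, mul_assoc]))
  have hzero : ∀ m, m ≠ i → m ≠ j → m ≠ k → a m = 0 := fun m hmi hmj hmk => by
    by_contra h0
    apply hαβ
    apply mul_right_cancel₀ h0
    rw [← hac m hmj, hbc m hmk, hab m hmi, mul_assoc]
  by_cases hjk : j = k
  · subst hjk
    left
    have haj : a j ≠ 0 := by
      obtain ⟨m, hm, ham⟩ := ha.exists_ne i
      by_cases hmj : m = j
      · exact hmj ▸ ham
      · exact absurd (hzero m hm hmj hmj) ham
    have hcj : c j ≠ 0 := by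
      obtain ⟨m, hm, hcm⟩ := hc.exists_ne i
      by_cases hmj : m = j
      · exact hmj ▸ hcm
      · exact absurd (by rw [hac m hmj, hzero m hm hmj hmj, mul_zero]) hcm
    refine ⟨c j / a j, div_ne_zero hcj haj, fun m hm => ?_⟩
    by_cases hmj : m = j
    · rw [hmj, div_mul_cancel₀ _ haj]
    · rw [hac m hmj, hzero m hm hmj hmj, mul_zero, mul_zero]
  · by_cases hcol : NearAt i a c
    · exact .inl hcol
    right
    obtain ⟨l, hli, hlj, hlk, hall⟩ := exists_forall_eq_of_distinct i j k (Ne.symm hji)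
      (Ne.symm hki) hjk
    have hai : a i ≠ 0 := fun h => hbi <| by
      rw [h, mul_zero] at hi
      rw [h, mul_zero, (mul_eq_zero.1 hi.symm).resolve_left hβ]
    have haj : a j ≠ 0 := fun h => hcol ⟨α, hα, fun m hm => by
      by_cases hmj : m = j
      · rw [hmj, hbc j hjk, hab j hji, h, mul_zero, mul_zero, mul_zero]
      · exact hac m hmj⟩
    have hak : a k ≠ 0 := fun h => hcol <| hab'.trans ⟨β, hβ, fun m hm => by
      by_cases hmk : m = k
      · rw [hmk, hac k (Ne.symm hjk), hab k hki, h, mul_zero, mul_zero, mul_zero]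
      · exact hbc m hmk⟩
    refine ⟨l, hli, fun m => ⟨fun h => ?_, fun h => h ▸ hzero l hli hlj hlk⟩⟩
    rcases hall m with rfl | rfl | rfl | rfl
    exacts [absurd h hai, absurd h haj, absurd h hak, rfl]

/-- The tops of the vectors which are near `a` at the coordinate `i`; the linear maximal cliques
are exactly these sets. -/
def axisLine (i : Fin 4) (a : Fin 4 → F) : Set (Set (Submodule F (Fin 4 → F))) :=
  {T | ∃ b, TwoSupp b ∧ NearAt i a b ∧ T = topOf b}

theorem NearAt.axisLine_eq {i : Fin 4} {a b : Fin 4 → F} (h : NearAt i a b) :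
    axisLine i a = axisLine i b :=
  Set.ext fun _ => ⟨fun ⟨c, hc, hac, hT⟩ => ⟨c, hc, h.symm.trans hac, hT⟩,
    fun ⟨c, hc, hbc, hT⟩ => ⟨c, hc, h.trans hbc, hT⟩⟩

variable [Fintype F]

theorem topOf_mem_axisLine_iff (hq : 3 ≤ Fintype.card F) {i : Fin 4} {a b : Fin 4 → F}
    (hb : TwoSupp b) : topOf b ∈ axisLine i a ↔ NearAt i a b := by
  refine ⟨fun ⟨c, hc, hac, h⟩ => ?_, fun h => ⟨b, hb, h, rfl⟩⟩
  obtain ⟨s, hs, rfl⟩ := (topOf_eq_topOf_iff hq hb hc).1 h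
  exact hac.trans (nearAt_smul i b hs).symm

theorem exists_ne_zero_ne (hq : 3 ≤ Fintype.card F) (y : F) : ∃ x : F, x ≠ 0 ∧ x ≠ y := by
  classical
  by_contra! hn
  have h1 : (Finset.univ : Finset F) ⊆ {0, y} := fun x _ => by
    by_cases hx : x = 0
    · simp [hx]
    · simp [hn x hx]
  have h2 := (Finset.card_le_card h1).trans Finset.card_le_two
  rw [Finset.card_univ] at h2
  omega

theorem TwoSupp.exists_nearAt_pair (hq : 3 ≤ Fintype.card F) {a : Fin 4 → F} (ha : TwoSupp a)
    (i : Fin 4) : ∃ b c, TwoSupp b ∧ TwoSupp c ∧ NearAt i a b ∧ NearAt i a c ∧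
      topOf b ≠ topOf c ∧ ¬ ∃ l, l ≠ i ∧ ∀ m, b m = 0 ↔ m = l := by
  obtain ⟨m, hmi, ham⟩ := ha.exists_ne i
  by_cases h0 : TwoSupp (Function.update a i 0)
  · have h1 : TwoSupp (Function.update a i 1) := ⟨m, i, hmi, by simp [hmi, ham], by simp⟩
    refine ⟨_, _, h0, h1, nearAt_update i a 0, nearAt_update i a 1, fun h => ?_, ?_⟩
    · obtain ⟨c, -, hc⟩ := (topOf_eq_topOf_iff hq h0 h1).1 h
      simpa using congrFun hc i
    · rintro ⟨l, hl, h⟩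
      exact hl ((h i).1 (by simp)).symm
  · obtain ⟨x, hx0, hxa⟩ := exists_ne_zero_ne hq (a i)
    have h1 : TwoSupp (Function.update a i x) := ⟨m, i, hmi, by simp [hmi, ham], by simpa⟩
    refine ⟨a, _, ha, h1, .refl i a, nearAt_update i a x, fun h => ?_, ?_⟩
    · obtain ⟨c, -, hc⟩ := (topOf_eq_topOf_iff hq ha h1).1 h
      have h2 := congrFun hc m
      have h3 := congrFun hc i
      simp only [Function.update_of_ne hmi, Function.update_self, Pi.smul_apply,
        smul_eq_mul] at h2 h3
      rw [(mul_eq_right₀ ham).1 h2.symm, one_mul] at h3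
      exact hxa h3
    · rintro ⟨l, hl, h⟩
      have hml : m ≠ l := fun hm => ham ((h m).2 hm)
      obtain ⟨n, hni, hnl, hnm, -⟩ := exists_forall_eq_of_distinct i l m (Ne.symm hl)
        (Ne.symm hmi) (Ne.symm hml)
      exact h0 ⟨m, n, Ne.symm hnm, by simp [hmi, ham], by simp [hni, h, hnl]⟩

theorem isCliqueDt'_axisLine (hq : 3 ≤ Fintype.card F) (i : Fin 4) (a : Fin 4 → F) :
    IsCliqueDt' F 4 2 (axisLine i a) := by
  constructor
  · rintro _ ⟨b, hb, -, rfl⟩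
    exact hb.isTopD_topOf hq
  · rintro _ ⟨b, hb, hab, rfl⟩ _ ⟨c, hc, hac, rfl⟩ hne
    exact (adjMC'_topOf_iff hq hb hc).2 ⟨hne, i, hab.symm.trans hac⟩

theorem IsCliqueDt'.subset_axisLine (hq : 3 ≤ Fintype.card F)
    {D : Set (Set (Submodule F (Fin 4 → F)))} (hD : IsCliqueDt' F 4 2 D) {i : Fin 4}
    {a b : Fin 4 → F} (ha : TwoSupp a) (hb : TwoSupp b) (haD : topOf a ∈ D) (hbD : topOf b ∈ D)
    (hne : topOf a ≠ topOf b) (hab : NearAt i a b)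
    (hz : ¬ ∃ l, l ≠ i ∧ ∀ m, a m = 0 ↔ m = l) : D ⊆ axisLine i a := by
  intro T hT
  obtain ⟨c, hc, rfl⟩ := exists_twoSupp_of_isTopD hq (hD.1 T hT)
  by_cases hac : topOf a = topOf c
  · exact hac ▸ ⟨a, ha, .refl i a, rfl⟩
  by_cases hbc : topOf b = topOf c
  · exact hbc ▸ ⟨b, hb, hab, rfl⟩
  obtain ⟨-, j, hac⟩ := (adjMC'_topOf_iff hq ha hc).1 (hD.2 _ haD _ hT hac)
  obtain ⟨-, k, hbc⟩ := (adjMC'_topOf_iff hq hb hc).1 (hD.2 _ hbD _ hT hbc)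
  refine ⟨c, hc, (hab.triangle ha hc hac hbc fun s hs h => ?_).resolve_right hz, rfl⟩
  exact hne ((topOf_eq_topOf_iff hq ha hb).2 ⟨s, hs, h⟩)

theorem isMaxCliqueDt'_axisLine (hq : 3 ≤ Fintype.card F) (i : Fin 4) {a : Fin 4 → F}
    (ha : TwoSupp a) : IsMaxCliqueDt' F 4 2 (axisLine i a) := by
  refine ⟨isCliqueDt'_axisLine hq i a, fun D hD hle => Set.Subset.antisymm ?_ hle⟩
  obtain ⟨b, c, hb, hc, hab, hac, hne, hz⟩ := ha.exists_nearAt_pair hq i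
  rw [hab.axisLine_eq]
  exact hD.subset_axisLine hq hb hc (hle ⟨b, hb, hab, rfl⟩) (hle ⟨c, hc, hac, rfl⟩) hne
    (hab.symm.trans hac) hz

variable {𝒳 : Set (Set (Submodule F (Fin 4 → F)))}

theorem IsMaxCliqueDt'.eq_axisLine (hq : 3 ≤ Fintype.card F) (h : IsMaxCliqueDt' F 4 2 𝒳)
    {i : Fin 4} {a : Fin 4 → F} (hle : 𝒳 ⊆ axisLine i a) : 𝒳 = axisLine i a :=
  (h.2 _ (isCliqueDt'_axisLine hq i a) hle).symm

theorem IsMaxCliqueDt'.exists_nearAt (hq : 3 ≤ Fintype.card F) (h : IsMaxCliqueDt' F 4 2 𝒳)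
    {a : Fin 4 → F} (ha : TwoSupp a) (haX : topOf a ∈ 𝒳) :
    ∃ i b, TwoSupp b ∧ topOf b ∈ 𝒳 ∧ topOf a ≠ topOf b ∧ NearAt i a b := by
  by_contra! hn
  have hsub : ∀ T ∈ 𝒳, T = topOf a := by
    intro T hT
    by_contra hTa
    obtain ⟨b, hb, rfl⟩ := exists_twoSupp_of_isTopD hq (h.1.1 T hT)
    obtain ⟨-, i, hab⟩ := (adjMC'_topOf_iff hq ha hb).1 (h.1.2 _ haX _ hT (Ne.symm hTa))
    exact hn i b hb hT (Ne.symm hTa) hab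
  have heq := h.eq_axisLine hq (i := 0) (a := a) fun T hT =>
    hsub T hT ▸ ⟨a, ha, .refl 0 a, rfl⟩
  obtain ⟨b, c, hb, hc, hab, hac, hne, -⟩ := ha.exists_nearAt_pair hq 0
  exact hne ((hsub _ (heq ▸ ⟨b, hb, hab, rfl⟩)).trans (hsub _ (heq ▸ ⟨c, hc, hac, rfl⟩)).symm)

theorem IsMaxCliqueDt'.exists_topOf_mem (hq : 3 ≤ Fintype.card F)
    (h : IsMaxCliqueDt' F 4 2 𝒳) : ∃ a, TwoSupp a ∧ topOf a ∈ 𝒳 := by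
  rcases 𝒳.eq_empty_or_nonempty with rfl | ⟨T, hT⟩
  · have hs : TwoSupp (fun _ => 1 : Fin 4 → F) := ⟨0, 1, by simp, by simp, by simp⟩
    have heq := h.eq_axisLine hq (Set.empty_subset (axisLine 0 (fun _ => 1 : Fin 4 → F)))
    exact ⟨_, hs, heq ▸ ⟨_, hs, .refl 0 _, rfl⟩⟩
  · obtain ⟨a, ha, rfl⟩ := exists_twoSupp_of_isTopD hq (h.1.1 T hT)
    exact ⟨a, ha, hT⟩

theorem IsCliqueDt'.exists_isMaxCliqueDt' (h : IsCliqueDt' F 4 2 𝒳) :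
    ∃ 𝒴, 𝒳 ⊆ 𝒴 ∧ IsMaxCliqueDt' F 4 2 𝒴 := by
  obtain ⟨𝒴, hle, hmax⟩ := Finite.exists_le_maximal h
  exact ⟨𝒴, hle, hmax.prop, fun D hD hYD => (hmax.eq_of_le hD hYD).symm⟩

theorem ncard_axisLine (hq : 3 ≤ Fintype.card F) (i : Fin 4) {a : Fin 4 → F} (ha : TwoSupp a) :
    (axisLine i a).ncard = {x : F | TwoSupp (Function.update a i x)}.ncard := by
  have himage : axisLine i a =
      (fun x => topOf (Function.update a i x)) '' {x : F | TwoSupp (Function.update a i x)} := by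
    ext T
    constructor
    · rintro ⟨b, hb, ⟨c, hc, hab⟩, rfl⟩
      have hup : Function.update a i (c⁻¹ * b i) = c⁻¹ • b := by
        ext m
        by_cases hm : m = i
        · subst hm
          simp
        · simp [hm, hab m hm, hc]
      refine ⟨c⁻¹ * b i, ?_, ?_⟩
      · change TwoSupp _
        rwa [hup, twoSupp_smul (inv_ne_zero hc)]
      · simp only [hup]
        exact topOf_smul (inv_ne_zero hc)
    · rintro ⟨x, hx, rfl⟩
      exact ⟨_, hx, nearAt_update i a x, rfl⟩
  rw [himage, Set.InjOn.ncard_image]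
  intro x hx y hy hxy
  obtain ⟨m, hm, ham⟩ := ha.exists_ne i
  obtain ⟨c, -, hc⟩ := (topOf_eq_topOf_iff hq hx hy).1 hxy
  have h2 := congrFun hc m
  have h3 := congrFun hc i
  simp only [Function.update_of_ne hm, Function.update_self, Pi.smul_apply, smul_eq_mul] at h2 h3
  rw [(mul_eq_right₀ ham).1 h2.symm, one_mul] at h3
  exact h3.symm

end AxisLines

section Types

variable {F : Type*} [Field F]

theorem coordHyp_inf_hyp_le_hyp_iff {i : Fin 4} {a b : Fin 4 → F} :
    coordHyp F 4 i ⊓ hyp a ≤ hyp b ↔ ∃ c : F, ∀ m, m ≠ i → b m = c * a m := by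
  constructor
  · intro h
    rw [coordHyp_eq_hyp] at h
    obtain ⟨s, t, rfl⟩ := exists_comb_of_inf_hyp_le h
    exact ⟨t, fun m hm => by simp [hm]⟩
  · rintro ⟨c, h⟩ x ⟨hxi, hxa⟩
    have hxi := mem_coordHyp.1 hxi
    have hxa := mem_hyp.1 hxa
    have heq : b = c • a + (b i - c * a i) • Pi.single i 1 := funext fun m => by
      by_cases hm : m = i
      · subst hm
        simp
      · simp [hm, h m hm]
    rw [mem_hyp, heq]
    simp [add_dotProduct, hxa, hxi]

theorem topsThrough_coordHyp_inf_hyp {i : Fin 4} {a : Fin 4 → F} :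
    TopsThrough F 4 2 (coordHyp F 4 i ⊓ hyp a) = axisLine i a := by
  ext T
  constructor
  · rintro ⟨Y, hY, hnd, hle, rfl⟩
    obtain ⟨b, hb0, rfl⟩ := exists_eq_hyp hY
    have hb := twoSupp_of_isNondeg_hyp hb0 hnd
    obtain ⟨c, hc⟩ := coordHyp_inf_hyp_le_hyp_iff.1 hle
    refine ⟨b, hb, ⟨c, ?_, hc⟩, rfl⟩
    rintro rfl
    obtain ⟨m, hm, hbm⟩ := hb.exists_ne i
    exact hbm (by simpa using hc m hm)
  · rintro ⟨b, hb, ⟨c, -, hc⟩, rfl⟩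
    exact ⟨hyp b, finrank_hyp hb.ne_zero, hb.isNondeg_hyp,
      coordHyp_inf_hyp_le_hyp_iff.2 ⟨c, hc⟩, rfl⟩

theorem finrank_coordHyp_inf_hyp {i : Fin 4} {a : Fin 4 → F} (h : ∃ m, m ≠ i ∧ a m ≠ 0) :
    finrank F ↥(coordHyp F 4 i ⊓ hyp a) = 2 := by
  obtain ⟨m, hm, ham⟩ := h
  have h1 := finrank_inf_hyp (A := coordHyp F 4 i) (b := a) fun hle => by
    have := mem_hyp.1 (hle (mem_coordHyp.2 (by simp [hm.symm] : (Pi.single m 1 : Fin 4 → F) i = 0)))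
    simp [ham] at this
  rw [coordHyp_eq_hyp, finrank_hyp (by simp)] at h1
  rw [coordHyp_eq_hyp]
  omega

theorem exists_eq_coordHyp_inf_hyp {X : Submodule F (Fin 4 → F)} (hX : finrank F X = 2)
    (hdeg : IsDeg F 4 X) : ∃ i a, TwoSupp a ∧ X = coordHyp F 4 i ⊓ hyp a := by
  obtain ⟨i, hi⟩ := hdeg
  obtain ⟨w, hwi, hwX⟩ : ∃ w ∈ coordHyp F 4 i, w ∉ X := by
    by_contra! hn
    have h1 := Submodule.finrank_mono (show coordHyp F 4 i ≤ X from hn)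
    rw [coordHyp_eq_hyp, finrank_hyp (by simp)] at h1
    omega
  obtain ⟨f, hfw, hXf⟩ := Submodule.exists_le_ker_of_notMem hwX
  obtain ⟨a, rfl⟩ := (dotProductEquiv F (Fin 4)).surjective f
  have hwi := mem_coordHyp.1 hwi
  obtain ⟨m, hm, ham⟩ : ∃ m, m ≠ i ∧ a m ≠ 0 := by
    by_contra! hn
    rw [dotProductEquiv_apply_apply] at hfw
    refine hfw (Finset.sum_eq_zero fun m _ => ?_)
    by_cases hm : m = i
    · rw [hm, hwi, mul_zero]
    · rw [hn m hm, zero_mul]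
  refine ⟨i, Function.update a i 1, ⟨m, i, hm, by simp [hm, ham], by simp⟩, ?_⟩
  refine Submodule.eq_of_le_of_finrank_eq
    ((le_inf hi hXf).trans (le_inf inf_le_left ?_)) ?_
  · exact coordHyp_inf_hyp_le_hyp_iff.2 ⟨1, fun m hm => by simp [hm]⟩
  · rw [hX, finrank_coordHyp_inf_hyp ⟨m, hm, by simp [hm, ham]⟩]

theorem exists_eq_topsThrough_iff {φ : Submodule F (Fin 4 → F) → Prop}
    {𝒳 : Set (Set (Submodule F (Fin 4 → F)))} :
    (∃ X : Submodule F (Fin 4 → F), finrank F ↥X = 2 ∧ IsDeg F 4 X ∧ 𝒳 = TopsThrough F 4 2 X ∧ φ X) ↔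
      ∃ i a, TwoSupp a ∧ 𝒳 = axisLine i a ∧ φ (coordHyp F 4 i ⊓ hyp a) := by
  constructor
  · rintro ⟨X, hX, hdeg, rfl, hφ⟩
    obtain ⟨i, a, ha, rfl⟩ := exists_eq_coordHyp_inf_hyp hX hdeg
    exact ⟨i, a, ha, topsThrough_coordHyp_inf_hyp, hφ⟩
  · rintro ⟨i, a, ha, rfl, hφ⟩
    exact ⟨_, finrank_coordHyp_inf_hyp (ha.exists_ne i), ⟨i, inf_le_left⟩,
      topsThrough_coordHyp_inf_hyp.symm, hφ⟩

theorem span_single_le_coordHyp_inf_hyp_iff {i j : Fin 4} {a : Fin 4 → F} :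
    Submodule.span F {Pi.single j (1 : F)} ≤ coordHyp F 4 i ⊓ hyp a ↔ j ≠ i ∧ a j = 0 := by
  rw [Submodule.span_singleton_le_iff_mem, Submodule.mem_inf, mem_coordHyp, mem_hyp]
  simp [Pi.single_apply, eq_comm]

theorem coordHyp_inf_hyp_le_coordHyp_inf_coordHyp_iff {i : Fin 4} {a : Fin 4 → F}
    (ha : TwoSupp a) :
    (∃ k l, k ≠ l ∧ coordHyp F 4 i ⊓ hyp a ≤ coordHyp F 4 k ⊓ coordHyp F 4 l) ↔
      ∃ k, k ≠ i ∧ ∀ m, m ≠ i → m ≠ k → a m = 0 := by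
  have key : ∀ k, k ≠ i → coordHyp F 4 i ⊓ hyp a ≤ coordHyp F 4 k →
      ∃ k, k ≠ i ∧ ∀ m, m ≠ i → m ≠ k → a m = 0 := by
    intro k hk h
    rw [coordHyp_eq_hyp k, coordHyp_inf_hyp_le_hyp_iff] at h
    obtain ⟨c, hc⟩ := h
    have hck := hc k hk
    refine ⟨k, hk, fun m hmi hmk => ?_⟩
    have hcm := hc m hmi
    rw [Pi.single_eq_same] at hck
    rw [Pi.single_eq_of_ne hmk] at hcm
    refine (mul_eq_zero.1 hcm.symm).resolve_left ?_
    rintro rfl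
    simp at hck
  constructor
  · rintro ⟨k, l, hkl, h⟩
    by_cases hk : k = i
    · exact key l (fun hl => hkl (hk.trans hl.symm)) (h.trans inf_le_right)
    · exact key k hk (h.trans inf_le_left)
  · rintro ⟨k, hk, h⟩
    have hak : a k ≠ 0 := by
      obtain ⟨m, hm, ham⟩ := ha.exists_ne i
      by_cases hmk : m = k
      · exact hmk ▸ ham
      · exact absurd (h m hm hmk) ham
    refine ⟨k, i, hk, le_inf ?_ inf_le_left⟩
    rw [coordHyp_eq_hyp k, coordHyp_inf_hyp_le_hyp_iff]
    refine ⟨(a k)⁻¹, fun m hm => ?_⟩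
    by_cases hmk : m = k
    · subst hmk
      simp [hak]
    · simp [hmk, h m hm hmk]

theorem not_exists_forall_eq_zero {i l : Fin 4} {a : Fin 4 → F} (hli : l ≠ i)
    (hl : ∀ m, a m = 0 ↔ m = l) : ¬ ∃ k, k ≠ i ∧ ∀ m, m ≠ i → m ≠ k → a m = 0 := by
  rintro ⟨k, hki, hk⟩
  by_cases hkl : k = l
  · obtain ⟨m, hmi, hml⟩ := (by decide : ∀ i l : Fin 4, ∃ m, m ≠ i ∧ m ≠ l) i l
    exact hml ((hl m).1 (hk m hmi (hkl ▸ hml)))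
  · obtain ⟨m, hmi, hmk, hml, -⟩ := exists_forall_eq_of_distinct i k l (Ne.symm hki)
      (Ne.symm hli) hkl
    exact hml ((hl m).1 (hk m hmi hmk))

variable [Fintype F] {𝒳 : Set (Set (Submodule F (Fin 4 → F)))}

theorem isLinMC1_iff (hq : 3 ≤ Fintype.card F) : IsLinMC1 F 𝒳 ↔
    ∃ i a, TwoSupp a ∧ 𝒳 = axisLine i a ∧ ∀ j, j ≠ i → a j ≠ 0 := by
  unfold IsLinMC1
  rw [exists_eq_topsThrough_iff]
  simp only [span_single_le_coordHyp_inf_hyp_iff, not_and]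
  refine ⟨And.right, fun h => ⟨?_, h⟩⟩
  obtain ⟨i, a, ha, rfl, -⟩ := h
  exact isMaxCliqueDt'_axisLine hq i ha

theorem isLinMC2_iff (hq : 3 ≤ Fintype.card F) : IsLinMC2 F 𝒳 ↔
    ∃ i a, TwoSupp a ∧ 𝒳 = axisLine i a ∧ ∃ k, k ≠ i ∧ ∀ m, m ≠ i → m ≠ k → a m = 0 := by
  unfold IsLinMC2
  rw [exists_eq_topsThrough_iff, exists_congr fun i => exists_congr fun a =>
    and_congr_right fun ha => by rw [coordHyp_inf_hyp_le_coordHyp_inf_coordHyp_iff ha]]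
  refine ⟨And.right, fun h => ⟨?_, h⟩⟩
  obtain ⟨i, a, ha, rfl, -⟩ := h
  exact isMaxCliqueDt'_axisLine hq i ha

theorem isLinMC3_iff (hq : 3 ≤ Fintype.card F) : IsLinMC3 F 𝒳 ↔
    ∃ i a, TwoSupp a ∧ 𝒳 = axisLine i a ∧ (∃ j, j ≠ i ∧ a j = 0) ∧
      ¬ ∃ k, k ≠ i ∧ ∀ m, m ≠ i → m ≠ k → a m = 0 := by
  unfold IsLinMC3
  rw [exists_eq_topsThrough_iff, exists_congr fun i => exists_congr fun a =>
    and_congr_right fun ha => by rw [coordHyp_inf_hyp_le_coordHyp_inf_coordHyp_iff ha]]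
  simp only [span_single_le_coordHyp_inf_hyp_iff]
  refine ⟨And.right, fun h => ⟨?_, h⟩⟩
  obtain ⟨i, a, ha, rfl, -⟩ := h
  exact isMaxCliqueDt'_axisLine hq i ha

theorem isLinMC_trichotomy (hq : 3 ≤ Fintype.card F) (i : Fin 4) {a : Fin 4 → F}
    (ha : TwoSupp a) : (IsLinMC1 F (axisLine i a) ∨ IsLinMC2 F (axisLine i a)) ∨
      IsLinMC3 F (axisLine i a) := by
  rw [isLinMC1_iff hq, isLinMC2_iff hq, isLinMC3_iff hq]
  by_cases h1 : ∃ j, j ≠ i ∧ a j = 0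
  · by_cases h2 : ∃ k, k ≠ i ∧ ∀ m, m ≠ i → m ≠ k → a m = 0
    · exact .inl (.inr ⟨i, a, ha, rfl, h2⟩)
    · exact .inr ⟨i, a, ha, rfl, h1, h2⟩
  · push Not at h1
    exact .inl (.inl ⟨i, a, ha, rfl, h1⟩)

/-- The coordinates of a vector defining a linear maximal clique of type 3. -/
theorem IsLinMC3.exists_coords (hq : 3 ≤ Fintype.card F) (h : IsLinMC3 F 𝒳) :
    ∃ i j k l a, 𝒳 = axisLine i a ∧ a l = 0 ∧ a j ≠ 0 ∧ a k ≠ 0 ∧ i ≠ j ∧ i ≠ k ∧ j ≠ k ∧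
      l ≠ i ∧ l ≠ j ∧ l ≠ k ∧ ∀ m, m = i ∨ m = j ∨ m = k ∨ m = l := by
  obtain ⟨i, a, ha, rfl, ⟨l', hl', hal⟩, hn⟩ := (isLinMC3_iff hq).1 h
  obtain ⟨j, hji, haj⟩ := ha.exists_ne i
  push Not at hn
  obtain ⟨k, hki, hkj, hak⟩ := hn j hji
  obtain ⟨l, hli, hlj, hlk, hall⟩ :=
    exists_forall_eq_of_distinct i j k (Ne.symm hji) (Ne.symm hki) (Ne.symm hkj)
  refine ⟨i, j, k, l, a, rfl, ?_, haj, hak, Ne.symm hji, Ne.symm hki, Ne.symm hkj, hli, hlj, hlk,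
    hall⟩
  rcases hall l' with rfl | rfl | rfl | rfl
  exacts [absurd rfl hl', absurd hal haj, absurd hal hak, hal]

/-- A linear maximal clique of type 1 or 2 is the only maximal clique containing a given pair of
its elements. -/
theorem eq_of_not_subsingleton_inter (hq : 3 ≤ Fintype.card F)
    (h : IsLinMC1 F 𝒳 ∨ IsLinMC2 F 𝒳) {𝒴 : Set (Set (Submodule F (Fin 4 → F)))}
    (hY : IsMaxCliqueDt' F 4 2 𝒴) (hXY : ¬ (𝒳 ∩ 𝒴).Subsingleton) : 𝒴 = 𝒳 := by
  obtain ⟨i, a, ha, rfl, hz⟩ : ∃ i a, TwoSupp a ∧ 𝒳 = axisLine i a ∧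
      ∀ b, NearAt i a b → ¬ ∃ l, l ≠ i ∧ ∀ m, b m = 0 ↔ m = l := by
    rcases h with h | h
    · obtain ⟨i, a, ha, rfl, h0⟩ := (isLinMC1_iff hq).1 h
      refine ⟨i, a, ha, rfl, ?_⟩
      rintro b ⟨c, hc, hab⟩ ⟨l, hl, hb⟩
      have := hab l hl
      rw [(hb l).2 rfl] at this
      exact mul_ne_zero hc (h0 l hl) this.symm
    · obtain ⟨i, a, ha, rfl, k, hki, h0⟩ := (isLinMC2_iff hq).1 h
      refine ⟨i, a, ha, rfl, ?_⟩
      rintro b ⟨c, hc, hab⟩ ⟨l, hl, hb⟩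
      exact not_exists_forall_eq_zero hl hb
        ⟨k, hki, fun m hmi hmk => by rw [hab m hmi, h0 m hmi hmk, mul_zero]⟩
  rw [Set.not_subsingleton_iff] at hXY
  obtain ⟨_, ⟨⟨b, hb, hab, rfl⟩, hbY⟩, _, ⟨⟨c, hc, hac, rfl⟩, hcY⟩, hne⟩ := hXY
  rw [hab.axisLine_eq]
  exact hY.eq_axisLine hq
    (hY.1.subset_axisLine hq hb hc hbY hcY hne (hab.symm.trans hac) (hz b hab))

/-- A linear maximal clique of type 3 shares two elements with another maximal clique. -/
theorem IsLinMC3.exists_inter (hq : 3 ≤ Fintype.card F) (h : IsLinMC3 F 𝒳) :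
    ∃ 𝒴, IsMaxCliqueDt' F 4 2 𝒴 ∧ 𝒴 ≠ 𝒳 ∧ ¬ (𝒳 ∩ 𝒴).Subsingleton := by
  obtain ⟨i, j, k, l, a, rfl, hal, haj, hak, hij, hik, hjk, hli, hlj, hlk, hall⟩ :=
    h.exists_coords hq
  obtain ⟨t, ht0, ht1⟩ := exists_ne_zero_ne hq 1
  let b := Function.update a i 1
  let c := Function.update a i t
  let d := Function.update b k (a k / t)
  have hbj : b j = a j := by simp [b, hij.symm]
  have hcj : c j = a j := by simp [c, hij.symm]
  have hdj : d j = a j := by simp [d, hjk, hbj]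
  have hbi : b i = 1 := by simp [b]
  have hci : c i = t := by simp [c]
  have hdi : d i = 1 := by simp [d, hik, hbi]
  have hbl : b l = 0 := by simp [b, hli, hal]
  have hcl : c l = 0 := by simp [c, hli, hal]
  have hdl : d l = 0 := by simp [d, hlk, hbl]
  have hck : c k = a k := by simp [c, hik.symm]
  have hdk : d k = a k / t := by simp [d]
  have hb : TwoSupp b := ⟨i, j, hij, by simp [hbi], by simp [hbj, haj]⟩
  have hc : TwoSupp c := ⟨i, j, hij, by simp [hci, ht0], by simp [hcj, haj]⟩
  have hd : TwoSupp d := ⟨i, j, hij, by simp [hdi], by simp [hdj, haj]⟩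
  have hab : NearAt i a b := nearAt_update i a 1
  have hac : NearAt i a c := nearAt_update i a t
  have hbd : NearAt k b d := nearAt_update k b _
  have hcd : NearAt j c d := by
    refine ⟨t⁻¹, inv_ne_zero ht0, fun m hm => ?_⟩
    rcases hall m with rfl | rfl | rfl | rfl
    · rw [hdi, hci, inv_mul_cancel₀ ht0]
    · exact absurd rfl hm
    · rw [hdk, hck, div_eq_inv_mul]
    · rw [hdl, hcl, mul_zero]
  have hbc : topOf b ≠ topOf c := by
    intro h
    obtain ⟨s, -, hs⟩ := (topOf_eq_topOf_iff hq hb hc).1 h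
    have h1 := congrFun hs i
    have h2 := congrFun hs j
    simp only [Pi.smul_apply, smul_eq_mul, hbi, hci, hbj, hcj] at h1 h2
    rw [(mul_eq_right₀ haj).1 h2.symm, one_mul] at h1
    exact ht1 h1
  have hadj : ∀ {u v : Fin 4 → F}, TwoSupp u → TwoSupp v → ∀ n, NearAt n u v →
      topOf u ≠ topOf v → AdjMC' F 4 2 (topOf u) (topOf v) := fun hu hv n huv hne =>
    (adjMC'_topOf_iff hq hu hv).2 ⟨hne, n, huv⟩
  have hcl : IsCliqueDt' F 4 2 {topOf b, topOf c, topOf d} := by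
    constructor
    · rintro _ (rfl | rfl | rfl)
      exacts [hb.isTopD_topOf hq, hc.isTopD_topOf hq, hd.isTopD_topOf hq]
    · rintro _ (rfl | rfl | rfl) _ (rfl | rfl | rfl) hne
      exacts [absurd rfl hne, hadj hb hc i (hab.symm.trans hac) hne, hadj hb hd k hbd hne,
        hadj hc hb i (hac.symm.trans hab) hne, absurd rfl hne, hadj hc hd j hcd hne,
        hadj hd hb k hbd.symm hne, hadj hd hc j hcd.symm hne, absurd rfl hne]
  obtain ⟨𝒴, hle, hmax⟩ := hcl.exists_isMaxCliqueDt'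
  refine ⟨𝒴, hmax, ?_, fun hs => hbc (hs ⟨⟨b, hb, hab, rfl⟩, hle (by simp)⟩
    ⟨⟨c, hc, hac, rfl⟩, hle (by simp)⟩)⟩
  rintro rfl
  obtain ⟨s, -, hs⟩ := (topOf_mem_axisLine_iff hq hd).1 (hle (by simp : topOf d ∈ _))
  have h1 := hs j hij.symm
  have h2 := hs k hik.symm
  rw [hdj] at h1
  rw [(mul_eq_right₀ haj).1 h1.symm, one_mul, hdk, div_eq_iff ht0] at h2
  exact ht1 ((mul_eq_left₀ hak).1 h2.symm)

theorem IsLinMC1.ncard_eq (hq : 3 ≤ Fintype.card F) (h : IsLinMC1 F 𝒳) :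
    𝒳.ncard = Fintype.card F := by
  obtain ⟨i, a, ha, rfl, h0⟩ := (isLinMC1_iff hq).1 h
  obtain ⟨m, n, hmi, hni, hmn⟩ :=
    (by decide : ∀ i : Fin 4, ∃ m n, m ≠ i ∧ n ≠ i ∧ m ≠ n) i
  rw [ncard_axisLine hq i ha, show {x : F | TwoSupp (Function.update a i x)} = Set.univ from
    Set.eq_univ_of_forall fun x => ⟨m, n, hmn, by simp [hmi, h0 m hmi], by simp [hni, h0 n hni]⟩,
    Set.ncard_univ, Nat.card_eq_fintype_card]

theorem IsLinMC2.ncard_eq (hq : 3 ≤ Fintype.card F) (h : IsLinMC2 F 𝒳) :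
    𝒳.ncard = Fintype.card F - 1 := by
  obtain ⟨i, a, ha, rfl, k, hki, h0⟩ := (isLinMC2_iff hq).1 h
  have hset : {x : F | TwoSupp (Function.update a i x)} = {0}ᶜ := by
    ext x
    constructor
    · rintro hx rfl
      obtain ⟨m, hm, ham⟩ := TwoSupp.exists_ne hx k
      by_cases hmi : m = i
      · simp [hmi] at ham
      · simp [hmi, h0 m hmi hm] at ham
    · intro hx
      obtain ⟨m, hm, ham⟩ := ha.exists_ne i
      exact ⟨m, i, hm, by simp [hm, ham], by simpa using hx⟩
  rw [ncard_axisLine hq i ha, hset, Set.ncard_compl, Set.ncard_singleton,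
    Nat.card_eq_fintype_card]

theorem IsLinMC3.exists_isLinMC2_inter (hq : 3 ≤ Fintype.card F) (h : IsLinMC3 F 𝒳) :
    ∃ 𝒴, IsLinMC2 F 𝒴 ∧ (𝒳 ∩ 𝒴).Nonempty := by
  obtain ⟨i, j, k, l, a, rfl, hal, haj, hak, hij, hik, hjk, hli, hlj, hlk, hall⟩ :=
    h.exists_coords hq
  have hb : TwoSupp (Function.update a i 0) :=
    ⟨j, k, hjk, by simp [hij.symm, haj], by simp [hik.symm, hak]⟩
  refine ⟨axisLine j (Function.update a i 0), (isLinMC2_iff hq).2 ⟨j, _, hb, rfl, k, hjk.symm, ?_⟩,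
    topOf (Function.update a i 0), ⟨_, hb, nearAt_update i a 0, rfl⟩, ⟨_, hb, .refl j _, rfl⟩⟩
  intro m hmj hmk
  rcases hall m with rfl | rfl | rfl | rfl
  · simp
  · exact absurd rfl hmj
  · exact absurd rfl hmk
  · simp [hli, hal]

theorem IsMaxCliqueDt'.exists_eq_axisLine_of_inter (hq : 3 ≤ Fintype.card F)
    (hX : IsMaxCliqueDt' F 4 2 𝒳) {𝒴 : Set (Set (Submodule F (Fin 4 → F)))}
    (hY : IsLinMC2 F 𝒴) (hXY : (𝒳 ∩ 𝒴).Nonempty) :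
    ∃ i a, TwoSupp a ∧ 𝒳 = axisLine i a := by
  obtain ⟨j, a, ha, rfl, k, -, hk⟩ := (isLinMC2_iff hq).1 hY
  obtain ⟨_, hpX, p, hp, ⟨c, hc, hap⟩, rfl⟩ := hXY
  obtain ⟨i, b, hb, hbX, hne, hpb⟩ := hX.exists_nearAt hq hp hpX
  refine ⟨i, p, hp, hX.eq_axisLine hq (hX.1.subset_axisLine hq hp hb hpX hbX hne hpb ?_)⟩
  rintro ⟨l, -, hl⟩
  have hpz : ∀ m, m ≠ j → m ≠ k → m = l := fun m hmj hmk =>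
    (hl m).1 (by rw [hap m hmj, hk m hmj hmk, mul_zero])
  obtain ⟨m, hmj, hmk, hml⟩ :=
    (by decide : ∀ j k l : Fin 4, ∃ m, m ≠ j ∧ m ≠ k ∧ m ≠ l) j k l
  exact hml (hpz m hmj hmk)

end Types


/-- for `F = F_q`, `q ≥ 3`, `n = 4`, `k = 2`:
(1) a maximal clique of `Δ'_t` is linear of type 1 or 2 iff it meets every other maximal
clique of `Δ'_t` in at most one element;
(2) a linear maximal clique of type 1 or 2 is of type 2 iff it has exactly `q - 1` elements;
(3) a maximal clique which is not linear of type 1 or 2 is linear of type 3 iff it meets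
some linear maximal clique of type 2. -/
theorem stmt17 (F : Type*) [Field F] [Fintype F] (q : ℕ)
    (hq : Fintype.card F = q) (hq3 : 3 ≤ q) :
    (∀ 𝒳 : Set (Set (Submodule F (Fin 4 → F))), IsMaxCliqueDt' F 4 2 𝒳 →
      ((IsLinMC1 F 𝒳 ∨ IsLinMC2 F 𝒳) ↔
        ∀ 𝒴 : Set (Set (Submodule F (Fin 4 → F))), IsMaxCliqueDt' F 4 2 𝒴 → 𝒴 ≠ 𝒳 →
          (𝒳 ∩ 𝒴).Subsingleton)) ∧
    (∀ 𝒳 : Set (Set (Submodule F (Fin 4 → F))), (IsLinMC1 F 𝒳 ∨ IsLinMC2 F 𝒳) →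
      (IsLinMC2 F 𝒳 ↔ 𝒳.ncard = q - 1)) ∧
    (∀ 𝒳 : Set (Set (Submodule F (Fin 4 → F))), IsMaxCliqueDt' F 4 2 𝒳 →
      ¬ (IsLinMC1 F 𝒳 ∨ IsLinMC2 F 𝒳) →
      (IsLinMC3 F 𝒳 ↔
        ∃ 𝒴 : Set (Set (Submodule F (Fin 4 → F))), IsLinMC2 F 𝒴 ∧ (𝒳 ∩ 𝒴).Nonempty)) := by
  subst hq
  refine ⟨fun 𝒳 hX => ⟨fun h 𝒴 hY hne => ?_, fun h => ?_⟩, fun 𝒳 h12 => ⟨fun h => ?_, fun h => ?_⟩,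
    fun 𝒳 hX h12 => ⟨fun h => h.exists_isLinMC2_inter hq3, ?_⟩⟩
  · by_contra hs
    exact hne (eq_of_not_subsingleton_inter hq3 h hY hs)
  · obtain ⟨a, ha, haX⟩ := hX.exists_topOf_mem hq3
    obtain ⟨i, b, hb, hbX, hab, hnear⟩ := hX.exists_nearAt hq3 ha haX
    have heq : axisLine i a = 𝒳 := by
      by_contra hne
      exact hab (h _ (isMaxCliqueDt'_axisLine hq3 i ha) hne ⟨haX, a, ha, .refl i a, rfl⟩
        ⟨hbX, b, hb, hnear, rfl⟩)
    subst heq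
    refine (isLinMC_trichotomy hq3 i ha).resolve_right fun h3 => ?_
    obtain ⟨𝒴, hY, hne, hs⟩ := h3.exists_inter hq3
    exact hs (h 𝒴 hY hne)
  · exact h.ncard_eq hq3
  · refine h12.resolve_left fun h1 => ?_
    rw [h1.ncard_eq hq3] at h
    omega
  · rintro ⟨𝒴, hY, hXY⟩
    obtain ⟨i, a, ha, rfl⟩ := hX.exists_eq_axisLine_of_inter hq3 hY hXY
    exact (isLinMC_trichotomy hq3 i ha).resolve_left h12
end
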